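/- For any undirected, loopless, connected graph G on vertex set {0,1,...,n}, the polynomial P_G(x) = Σ x^{sum(a)} over all G-parking functions a has log-concave coefficients. -/

import Mathlib

/-- A polynomial has log-concave coefficients if `a_{i-1} * a_{i+1} ≤ a_i ^ 2` for all
interior indices (the inequality is trivial outside the support). -/
def PolyLogConcave (p : Polynomial ℤ) : Prop :=
  ∀ i : ℕ, p.coeff i * p.coeff (i + 2) ≤ p.coeff (i + 1) ^ 2

/-- `dOut G I i` is the number of edges of `G` between the vertex `i` and vertices not in `I`. -/
noncomputable def dOut {n : ℕ} (G : SimpleGraph (Fin (n + 1))) (I : Finset (Fin (n + 1)))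
    (i : Fin (n + 1)) : ℕ :=
  Nat.card {v : Fin (n + 1) // G.Adj i v ∧ v ∉ I}

/-- A `G`-parking function for a graph `G` on vertex set `{0, 1, ..., n}`: a sequence
`(a_1, ..., a_n)` of positive integers (indexed by the nonzero vertices, `Fin.succ` of `Fin n`)
such that for every nonempty `I ⊆ {1, ..., n}` there is `i ∈ I` with `a_i ≤ d_I(i)`. -/
def IsGParkingFunction {n : ℕ} (G : SimpleGraph (Fin (n + 1))) (a : Fin n → ℕ) : Prop :=
  (∀ i, 1 ≤ a i) ∧
    ∀ I : Finset (Fin n), I.Nonempty → ∃ i ∈ I, a i ≤ dOut G (I.image Fin.succ) i.succ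

/-- The sum enumerator of `G`-parking functions. -/
noncomputable def gpfPoly {n : ℕ} (G : SimpleGraph (Fin (n + 1))) : Polynomial ℤ :=
  ∑ᶠ a : {a : Fin n → ℕ // IsGParkingFunction G a}, (Polynomial.X : Polynomial ℤ) ^ (∑ i, a.1 i)

set_option linter.unusedSectionVars false

namespace GParking

open Finset

section Chains

variable {E : Type*} [Fintype E] [DecidableEq E]

/-- A chain of nonempty proper subsets of a finite set. -/
structure IsProperChain (C : Finset (Finset E)) : Prop where
  total : ∀ S ∈ C, ∀ T ∈ C, S ⊆ T ∨ T ⊆ S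
  empty_notMem : ∅ ∉ C
  univ_notMem : univ ∉ C

/-- The union of the members of `C` avoiding `e`. -/
def lo (C : Finset (Finset E)) (e : E) : Finset E := (C.filter (e ∉ ·)).sup id

/-- `lo C e` together with `e`. -/
def hi (C : Finset (Finset E)) (e : E) : Finset E := insert e (lo C e)

/-- The elements `a` and `b` lie in the same members of `C`. -/
def Unsep (C : Finset (Finset E)) (a b : E) : Prop := ∀ T ∈ C, a ∈ T ↔ b ∈ T

open Classical in
/-- The sets extending the proper chain `C` to a strictly larger one. -/
noncomputable def comp (C : Finset (Finset E)) : Finset (Finset E) :=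
  univ.filter fun T => T ∉ C ∧ IsProperChain (insert T C)

open Classical in
variable (E) in
/-- The maximal proper chains. -/
noncomputable def maxChains : Finset (Finset (Finset E)) :=
  univ.filter fun C => IsProperChain C ∧ C.card + 1 = Fintype.card E

variable {C D : Finset (Finset E)} {S T : Finset E} {e a b : E}

lemma mem_lo {g : E} : g ∈ lo C e ↔ ∃ T ∈ C, e ∉ T ∧ g ∈ T := by
  simp [lo, Finset.mem_sup, and_assoc]

lemma notMem_lo : e ∉ lo C e := by
  rw [mem_lo]; rintro ⟨T, _, h, h'⟩; exact h h'

lemma subset_lo (hT : T ∈ C) (he : e ∉ T) : T ⊆ lo C e := fun _ hg => mem_lo.2 ⟨T, hT, he, hg⟩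

lemma IsProperChain.mono (hC : IsProperChain C) (h : D ⊆ C) : IsProperChain D :=
  ⟨fun S hS T hT => hC.total S (h hS) T (h hT), fun hh => hC.empty_notMem (h hh),
    fun hh => hC.univ_notMem (h hh)⟩

lemma isProperChain_empty : IsProperChain (∅ : Finset (Finset E)) := ⟨by simp, by simp, by simp⟩

lemma isProperChain_insert : IsProperChain (insert T C) ↔
    IsProperChain C ∧ T ≠ ∅ ∧ T ≠ univ ∧ ∀ S ∈ C, S ⊆ T ∨ T ⊆ S := by
  constructor
  · intro h
    refine ⟨h.mono (subset_insert _ _), ?_, ?_, fun S hS =>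
      h.total S (mem_insert_of_mem hS) T (mem_insert_self _ _)⟩
    · rintro rfl; exact h.empty_notMem (mem_insert_self _ _)
    · rintro rfl; exact h.univ_notMem (mem_insert_self _ _)
  · rintro ⟨hC, h1, h2, h3⟩
    refine ⟨?_, ?_, ?_⟩
    · intro A hA B hB
      rcases mem_insert.1 hA with hA' | hA' <;> rcases mem_insert.1 hB with hB' | hB'
      · exact Or.inl (hA'.trans hB'.symm).subset
      · exact hA' ▸ (h3 B hB').symm
      · exact hB' ▸ h3 A hA'
      · exact hC.total A hA' B hB'
    · intro h
      rcases mem_insert.1 h with h | h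
      · exact h1 h.symm
      · exact hC.empty_notMem h
    · intro h
      rcases mem_insert.1 h with h | h
      · exact h2 h.symm
      · exact hC.univ_notMem h

lemma mem_comp : T ∈ comp C ↔ T ∉ C ∧ IsProperChain (insert T C) := by simp [comp]

lemma mem_comp_iff (hC : IsProperChain C) : T ∈ comp C ↔
    T ∉ C ∧ T ≠ ∅ ∧ T ≠ univ ∧ ∀ S ∈ C, S ⊆ T ∨ T ⊆ S := by
  rw [mem_comp, isProperChain_insert]; tauto

lemma mem_maxChains : C ∈ maxChains E ↔ IsProperChain C ∧ C.card + 1 = Fintype.card E := by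
  simp [maxChains]

lemma IsProperChain.card_lt [Nonempty E] (hC : IsProperChain C) :
    C.card + 1 ≤ Fintype.card E := by
  have h : C.card ≤ (Finset.Ioo 0 (Fintype.card E)).card := by
    apply Finset.card_le_card_of_injOn Finset.card
    · intro T hT
      have h1 : T ≠ ∅ := fun h => hC.empty_notMem (h ▸ hT)
      have h2 : T ≠ univ := fun h => hC.univ_notMem (h ▸ hT)
      simp only [coe_Ioo, Set.mem_Ioo]
      exact ⟨card_pos.2 (nonempty_iff_ne_empty.2 h1),
        (card_lt_iff_ne_univ T).2 h2⟩
    · intro S hS T hT h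
      rcases hC.total S hS T hT with h' | h'
      · exact eq_of_subset_of_card_le h' h.ge
      · exact (eq_of_subset_of_card_le h' h.le).symm
  have := Fintype.card_pos (α := E)
  simp at h
  omega

lemma IsProperChain.lo_mem (hC : IsProperChain C) (e : E) : lo C e = ∅ ∨ lo C e ∈ C := by
  by_cases h : (C.filter (e ∉ ·)).Nonempty
  · right
    obtain ⟨T, hT, hmax⟩ := Finset.exists_max_image _ Finset.card h
    rw [mem_filter] at hT
    convert hT.1
    apply subset_antisymm _ (subset_lo hT.1 hT.2)
    intro g hg
    obtain ⟨S, hS, heS, hgS⟩ := mem_lo.1 hg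
    rcases hC.total S hS T hT.1 with h' | h'
    · exact h' hgS
    · rwa [eq_of_subset_of_card_le h' (hmax S (mem_filter.2 ⟨hS, heS⟩))]
  · left
    rw [not_nonempty_iff_eq_empty] at h
    simp [lo, h]

lemma IsProperChain.hi_subset (hC : IsProperChain C) (hT : T ∈ C) (he : e ∈ T) : hi C e ⊆ T := by
  intro g hg
  rcases mem_insert.1 hg with rfl | hg
  · exact he
  · obtain ⟨S, hS, heS, hgS⟩ := mem_lo.1 hg
    rcases hC.total S hS T hT with h | h
    · exact h hgS
    · exact absurd (h he) heS

lemma IsProperChain.hi_comparable (hC : IsProperChain C) (hT : T ∈ C) (e : E) :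
    T ⊆ hi C e ∨ hi C e ⊆ T := by
  by_cases he : e ∈ T
  · exact Or.inr (hC.hi_subset hT he)
  · exact Or.inl ((subset_lo hT he).trans (subset_insert _ _))

lemma IsProperChain.hi_mem_comp (hC : IsProperChain C) (hab : a ≠ b) (h : Unsep C a b) :
    hi C a ∈ comp C ∧ b ∉ hi C a := by
  have hb : b ∉ hi C a := by
    rw [hi, mem_insert, not_or]
    refine ⟨hab.symm, fun hb => ?_⟩
    obtain ⟨S, hS, h1, h2⟩ := mem_lo.1 hb
    exact h1 ((h S hS).2 h2)
  refine ⟨(mem_comp_iff hC).2 ⟨fun hm => hb ((h _ hm).1 (mem_insert_self _ _)),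
    (insert_nonempty _ _).ne_empty, fun hu => hb (hu ▸ mem_univ b),
    fun S hS => hC.hi_comparable hS a⟩, hb⟩

lemma card_insert_of_mem_comp (hT : T ∈ comp C) : (insert T C).card = C.card + 1 :=
  card_insert_of_notMem (mem_comp.1 hT).1

lemma IsProperChain.exists_unsep (hC : IsProperChain C) (h : C.card + 1 < Fintype.card E) :
    ∃ a b, a ≠ b ∧ Unsep C a b := by
  have : ¬ Function.Injective fun e => (⟨lo C e, by
      rcases hC.lo_mem e with h | h <;> simp [h]⟩ : {T // T ∈ insert ∅ C}) := by
    intro hinj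
    have := Fintype.card_le_of_injective _ hinj
    simp only [Fintype.card_coe] at this
    have := card_insert_le ∅ C
    omega
  simp only [Function.Injective, Subtype.mk.injEq, not_forall] at this
  obtain ⟨a, b, hab, hne⟩ := this
  refine ⟨a, b, hne, fun T hT => ?_⟩
  by_contra hcon
  by_cases ha : a ∈ T
  · have hb : b ∉ T := by tauto
    exact notMem_lo (hab ▸ subset_lo hT hb ha)
  · have hb : b ∈ T := by tauto
    exact notMem_lo (hab ▸ subset_lo hT ha hb)

lemma IsProperChain.exists_maxChain [Nonempty E] (hC : IsProperChain C) :
    ∃ D ∈ maxChains E, C ⊆ D := by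
  induction hn : Fintype.card E - C.card generalizing C with
  | zero => have := hC.card_lt; omega
  | succ n ih =>
    by_cases h : C.card + 1 = Fintype.card E
    · exact ⟨C, mem_maxChains.2 ⟨hC, h⟩, subset_rfl⟩
    · have := hC.card_lt
      obtain ⟨a, b, hab, hu⟩ := hC.exists_unsep (by omega)
      obtain ⟨h1, -⟩ := hC.hi_mem_comp hab hu
      obtain ⟨D, hD, hs⟩ := ih (mem_comp.1 h1).2 (by rw [card_insert_of_mem_comp h1]; omega)
      exact ⟨D, hD, (subset_insert _ _).trans hs⟩

lemma mem_of_comparable (hC : C ∈ maxChains E) (h : ∀ S ∈ C, S ⊆ T ∨ T ⊆ S) :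
    T ∈ C ∨ T = ∅ ∨ T = univ := by
  rw [mem_maxChains] at hC
  by_contra! hcon
  have hc : T ∈ comp C := (mem_comp_iff hC.1).2 ⟨hcon.1, hcon.2.1.ne_empty, hcon.2.2, h⟩
  have : Nonempty E := Fintype.card_pos_iff.1 (by omega)
  have := (mem_comp.1 hc).2.card_lt
  rw [card_insert_of_mem_comp hc] at this
  omega

lemma hi_mem (hC : C ∈ maxChains E) (e : E) : hi C e ∈ C ∨ hi C e = univ := by
  have := mem_of_comparable hC fun S hS => (mem_maxChains.1 hC).1.hi_comparable hS e
  rcases this with h | h | h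
  · exact Or.inl h
  · exact absurd h (insert_nonempty _ _).ne_empty
  · exact Or.inr h

lemma exists_sep (hC : C ∈ maxChains E) (hab : a ≠ b) : ¬ Unsep C a b := by
  intro h
  obtain ⟨h1, h2⟩ := (mem_maxChains.1 hC).1.hi_mem_comp hab h
  rcases hi_mem hC a with h' | h'
  · exact (mem_comp.1 h1).1 h'
  · exact h2 (h' ▸ mem_univ _)

lemma hi_subset_lo_or (hC : C ∈ maxChains E) (hab : a ≠ b) : hi C a ⊆ lo C b ∨ hi C b ⊆ lo C a := by
  have := exists_sep hC hab
  simp only [Unsep, not_forall] at this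
  obtain ⟨T, hT, h⟩ := this
  have hch := (mem_maxChains.1 hC).1
  by_cases ha : a ∈ T
  · exact Or.inl ((hch.hi_subset hT ha).trans (subset_lo hT (by tauto)))
  · exact Or.inr ((hch.hi_subset hT (by tauto)).trans (subset_lo hT ha))

lemma lo_injective (hC : C ∈ maxChains E) : Function.Injective (lo C) := by
  intro a b hab
  by_contra hne
  rcases hi_subset_lo_or hC hne with h | h
  · exact notMem_lo (hab ▸ h (mem_insert_self a _))
  · exact notMem_lo (hab ▸ h (mem_insert_self b _))

lemma hi_injective (hC : C ∈ maxChains E) : Function.Injective (hi C) := by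
  intro a b hab
  by_contra hne
  rcases hi_subset_lo_or hC hne with h | h
  · exact notMem_lo (h (hab ▸ mem_insert_self b _))
  · exact notMem_lo (h (hab ▸ mem_insert_self a _))

lemma exists_lo_eq (hC : C ∈ maxChains E) (hT : T ∈ C ∨ T = ∅) : ∃ b, lo C b = T := by
  have hch := (mem_maxChains.1 hC)
  have : univ.image (lo C) = insert ∅ C := by
    apply eq_of_subset_of_card_le
    · intro T hT
      obtain ⟨e, -, rfl⟩ := mem_image.1 hT
      rcases hch.1.lo_mem e with h | h <;> simp [h]
    · rw [card_image_of_injective _ (lo_injective hC), card_univ, ← hch.2]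
      exact card_insert_le _ _
  have hT' : T ∈ insert ∅ C := by rcases hT with h | h <;> simp [h]
  rw [← this] at hT'
  simpa using hT'

lemma exists_hi_eq (hC : C ∈ maxChains E) (hT : T ∈ C ∨ T = univ) : ∃ a, hi C a = T := by
  have hch := (mem_maxChains.1 hC)
  have : univ.image (hi C) = insert univ C := by
    apply eq_of_subset_of_card_le
    · intro T hT
      obtain ⟨e, -, rfl⟩ := mem_image.1 hT
      rcases hi_mem hC e with h | h <;> simp [h]
    · rw [card_image_of_injective _ (hi_injective hC), card_univ, ← hch.2]
      exact card_insert_le _ _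
  have hT' : T ∈ insert univ C := by rcases hT with h | h <;> simp [h]
  rw [← this] at hT'
  simpa using hT'

end Chains

section ChainSums

variable {E : Type*} [Fintype E] [DecidableEq E] (t : E → ℝ)

/-- The piecewise linear function with value `x T` on the ray of `T`, evaluated at `t` using the
cone of `C`. -/
noncomputable def lin (C : Finset (Finset E)) : (Finset E → ℝ) →ₗ[ℝ] ℝ :=
  ∑ e, t e • ((LinearMap.proj (hi C e) : (Finset E → ℝ) →ₗ[ℝ] ℝ) - LinearMap.proj (lo C e))

/-- The indicator function of a single set. -/
noncomputable def ind (T : Finset E) : Finset E → ℝ := Pi.single T 1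

/-- The modular function with constant `c` and weights `l`. -/
def modular (c : ℝ) (l : E → ℝ) (T : Finset E) : ℝ := c + ∑ e ∈ T, l e

open Classical in
/-- The localization sum over the maximal chains through `C`. -/
noncomputable def chainSum (C : Finset (Finset E)) : (Finset (Finset E) → ℝ) →ₗ[ℝ] ℝ :=
  ∑ ω ∈ (maxChains E).filter (C ⊆ ·),
    (∏ T ∈ ω \ C, (lin t ω (ind T))⁻¹) •
      (LinearMap.proj ω : (Finset (Finset E) → ℝ) →ₗ[ℝ] ℝ)

variable {t} {C D ω : Finset (Finset E)} {S T : Finset E} {a b e : E}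
  {G H : Finset (Finset E) → ℝ}

lemma lin_apply (x : Finset E → ℝ) : lin t C x = ∑ e, t e * (x (hi C e) - x (lo C e)) := by
  simp [lin]

lemma lin_modular (c : ℝ) (l : E → ℝ) : lin t C (modular c l) = ∑ e, l e * t e := by
  rw [lin_apply]
  refine sum_congr rfl fun e _ => ?_
  simp only [modular, hi, sum_insert notMem_lo]
  ring

lemma lin_eq_sum (x : Finset E → ℝ) : lin t C x = ∑ T, x T * lin t C (ind T) := by
  conv_lhs => rw [show x = ∑ T, x T • ind T by
    funext S; simp [ind, Pi.single_apply, Finset.sum_apply]]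
  rw [map_sum]
  simp

lemma lin_ind_of_notMem (hω : ω ∈ maxChains E) (h : T ∉ ω) (h0 : T ≠ ∅) (h1 : T ≠ univ) :
    lin t ω (ind T) = 0 := by
  rw [lin_apply]
  refine sum_eq_zero fun e _ => ?_
  have h2 : hi ω e ≠ T := by
    rintro rfl
    rcases hi_mem hω e with h' | h'
    · exact h h'
    · exact h1 h'
  have h3 : lo ω e ≠ T := by
    rintro rfl
    rcases (mem_maxChains.1 hω).1.lo_mem e with h' | h'
    · exact h0 h'
    · exact h h'
  simp [ind, h2, h3]

lemma lin_ind_of_mem (hω : ω ∈ maxChains E) (h : T ∈ ω) :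
    ∃ a b, hi ω a = T ∧ lo ω b = T ∧ lin t ω (ind T) = t a - t b := by
  obtain ⟨a, ha⟩ := exists_hi_eq hω (Or.inl h)
  obtain ⟨b, hb⟩ := exists_lo_eq hω (Or.inl h)
  refine ⟨a, b, ha, hb, ?_⟩
  have h2 : ∀ e, hi ω e = T ↔ e = a := fun e => by
    rw [← ha]; exact (hi_injective hω).eq_iff
  have h3 : ∀ e, lo ω e = T ↔ e = b := fun e => by
    rw [← hb]; exact (lo_injective hω).eq_iff
  simp [lin_apply, ind, Pi.single_apply, h2, h3, mul_sub, sum_sub_distrib]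

lemma lin_ind_ne_zero (ht : Function.Injective t) (hω : ω ∈ maxChains E) (h : T ∈ ω) :
    lin t ω (ind T) ≠ 0 := by
  obtain ⟨a, b, ha, hb, heq⟩ := lin_ind_of_mem (t := t) hω h
  rw [heq, sub_ne_zero]
  intro hh
  obtain rfl := ht hh
  exact notMem_lo (e := a) (C := ω) (hb ▸ ha ▸ mem_insert_self a _)

lemma chainSum_apply : chainSum t C G = ∑ ω ∈ (maxChains E).filter (C ⊆ ·),
    (∏ T ∈ ω \ C, (lin t ω (ind T))⁻¹) * G ω := by
  classical
  simp [chainSum]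

lemma chainSum_congr (h : ∀ ω ∈ maxChains E, C ⊆ ω → G ω = H ω) :
    chainSum t C G = chainSum t C H := by
  rw [chainSum_apply, chainSum_apply]
  refine sum_congr rfl fun ω hω => ?_
  rw [mem_filter] at hω
  rw [h ω hω.1 hω.2]

lemma chainSum_eq_zero (h : ¬ IsProperChain C) : chainSum t C G = 0 := by
  rw [chainSum_apply, filter_eq_empty_iff.2, sum_empty]
  intro ω hω hC
  exact h ((mem_maxChains.1 hω).1.mono hC)

lemma chainSum_of_mem_maxChains (hC : C ∈ maxChains E) : chainSum t C G = G C := by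
  rw [chainSum_apply]
  have : (maxChains E).filter (C ⊆ ·) = {C} := by
    ext ω
    simp only [mem_filter, mem_singleton]
    constructor
    · rintro ⟨h, h'⟩
      have h1 := (mem_maxChains.1 h).2
      have h2 := (mem_maxChains.1 hC).2
      exact (eq_of_subset_of_card_le h' (by omega)).symm
    · rintro rfl
      exact ⟨hC, subset_rfl⟩
  simp [this]

lemma chainSum_mul_ind (ht : Function.Injective t) (hT : T ∉ C) (h0 : T ≠ ∅) (h1 : T ≠ univ) :
    chainSum t C (fun ω => G ω * lin t ω (ind T)) = chainSum t (insert T C) G := by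
  rw [chainSum_apply, chainSum_apply]
  have hsub : (maxChains E).filter (insert T C ⊆ ·) ⊆ (maxChains E).filter (C ⊆ ·) := by
    intro ω
    simp only [mem_filter, insert_subset_iff]
    tauto
  rw [← sum_subset hsub]
  · refine sum_congr rfl fun ω hω => ?_
    simp only [mem_filter, insert_subset_iff] at hω
    have : ω \ C = insert T (ω \ insert T C) := by
      ext S
      simp only [mem_sdiff, mem_insert]
      grind
    rw [this, prod_insert (by simp)]
    have := lin_ind_ne_zero ht hω.1 hω.2.1
    field_simp
  · intro ω h2 h3
    simp only [mem_filter, insert_subset_iff, not_and] at h2 h3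
    rw [lin_ind_of_notMem h2.1 (fun h => h3 h2.1 h h2.2) h0 h1]
    simp

lemma chainSum_mul_lin (ht : Function.Injective t) {x : Finset E → ℝ} (hx : ∀ T ∈ C, x T = 0)
    (h0 : x ∅ = 0) (h1 : x univ = 0) :
    chainSum t C (fun ω => G ω * lin t ω x) =
      ∑ T ∈ comp C, x T * chainSum t (insert T C) G := by
  have : (fun ω => G ω * lin t ω x) =
      ∑ T, x T • fun ω => G ω * lin t ω (ind T) := by
    funext ω
    rw [lin_eq_sum, mul_sum, Finset.sum_apply]
    refine sum_congr rfl fun T _ => ?_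
    simp only [Pi.smul_apply, smul_eq_mul]
    ring
  rw [this, map_sum]
  symm
  apply sum_subset_zero_on_sdiff (subset_univ _)
  · intro T hT
    rw [map_smul, smul_eq_mul]
    by_cases h : T ∈ C
    · rw [hx T h, zero_mul]
    by_cases h' : T = ∅
    · rw [h', h0, zero_mul]
    by_cases h'' : T = univ
    · rw [h'', h1, zero_mul]
    rw [chainSum_mul_ind ht h h' h'', chainSum_eq_zero, mul_zero]
    intro hcon
    simp only [mem_sdiff, mem_univ, true_and, mem_comp] at hT
    exact hT ⟨h, hcon⟩
  · intro T hT
    rw [map_smul, smul_eq_mul]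
    have := mem_comp.1 hT
    have h2 := isProperChain_insert.1 this.2
    rw [chainSum_mul_ind ht this.1 h2.2.1 h2.2.2.1]

lemma chainSum_pair (ht : Function.Injective t) (h : Unsep C a b) :
    (t a - t b) * chainSum t C G = ∑ T ∈ comp C,
      ((if a ∈ T then 1 else 0) - (if b ∈ T then 1 else 0)) * chainSum t (insert T C) G := by
  have hm : ∀ T : Finset E, modular 0 (Pi.single a 1 - Pi.single b 1 : E → ℝ) T =
      (if a ∈ T then 1 else 0) - (if b ∈ T then 1 else 0) := by
    intro T
    simp [modular, Pi.single_apply]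
  have := chainSum_mul_lin (G := G) ht (C := C)
    (x := modular 0 (Pi.single a 1 - Pi.single b 1 : E → ℝ)) (fun T hT => by
      rw [hm]; have := h T hT; by_cases ha : a ∈ T <;> simp_all) (by simp [hm]) (by simp [hm])
  simp only [hm] at this
  rw [← this, ← smul_eq_mul, ← map_smul]
  refine chainSum_congr fun ω _ _ => ?_
  rw [lin_modular]
  simp [sub_mul, sum_sub_distrib, Pi.single_apply]
  ring

end ChainSums

section Swap

variable {E : Type*} [Fintype E] [DecidableEq E] {t : E → ℝ}
  {C D ω : Finset (Finset E)} {S T : Finset E} {a b e : E} {G H : Finset (Finset E) → ℝ}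

lemma Unsep.symm (h : Unsep C a b) : Unsep C b a := fun T hT => (h T hT).symm

lemma Unsep.lo_eq (h : Unsep C a b) : lo C a = lo C b := by
  unfold lo
  congr 1
  refine filter_congr fun T hT => ?_
  rw [h T hT]

lemma self_mem_hi : e ∈ hi C e := mem_insert_self _ _

lemma mem_iff_of_subset_or {Q : Finset E} {a' e' : E} (h : S ⊆ Q ∨ Q ⊆ S) (h1 : a ∈ S ↔ a' ∈ S)
    (h2 : e ∈ S ↔ e' ∈ S) (h3 : ¬ (e ∈ S ↔ a ∈ S)) (h4 : ¬ (a ∈ Q ↔ a' ∈ Q)) :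
    e ∈ Q ↔ e' ∈ Q := by
  rcases h with h | h <;> grind

lemma insert_mem_maxChains (hcard : D.card + 2 = Fintype.card E)
    (hT : T ∈ comp D) : insert T D ∈ maxChains E :=
  mem_maxChains.2 ⟨(mem_comp.1 hT).2, by rw [card_insert_of_mem_comp hT]; omega⟩

lemma eq_hi_of_mem_comp (hD : IsProperChain D) (hcard : D.card + 2 = Fintype.card E)
    (hT : T ∈ comp D) (hne : a ≠ b) (h : Unsep D a b) (ha : a ∈ T) (hb : b ∉ T) :
    T = hi D a := by
  have hω := insert_mem_maxChains hcard hT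
  have hT' := (mem_comp_iff hD).1 hT
  have hlo : lo D a ⊆ T := by
    rcases hD.lo_mem a with h' | h'
    · simp [h']
    · rcases hT'.2.2.2 _ h' with h'' | h''
      · exact h''
      · exact absurd (h'' ha) notMem_lo
  have hhi : hi D a ⊆ T := insert_subset ha hlo
  have := mem_of_comparable (T := hi D a) hω fun S hS => by
    rcases mem_insert.1 hS with rfl | hS
    · exact Or.inr hhi
    · exact hD.hi_comparable hS a
  obtain ⟨h1, h2⟩ := hD.hi_mem_comp hne h
  rcases this with h' | h' | h'
  · rcases mem_insert.1 h' with h' | h'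
    · exact h'.symm
    · exact absurd h' (mem_comp.1 h1).1
  · exact absurd h' (insert_nonempty _ _).ne_empty
  · exact absurd (h' ▸ mem_univ b) h2

lemma comp_eq_pair (hD : IsProperChain D) (hcard : D.card + 2 = Fintype.card E)
    (hne : a ≠ b) (h : Unsep D a b) : comp D = {hi D a, hi D b} := by
  ext T
  rw [mem_insert, mem_singleton]
  constructor
  · intro hT
    have hsep := exists_sep (insert_mem_maxChains hcard hT) hne
    have : ¬ (a ∈ T ↔ b ∈ T) := fun hh => hsep fun S hS => by
      rcases mem_insert.1 hS with rfl | hS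
      · exact hh
      · exact h S hS
    by_cases ha : a ∈ T
    · exact Or.inl (eq_hi_of_mem_comp hD hcard hT hne h ha (by tauto))
    · exact Or.inr (eq_hi_of_mem_comp hD hcard hT hne.symm h.symm (by tauto) ha)
  · rintro (rfl | rfl)
    · exact (hD.hi_mem_comp hne h).1
    · exact (hD.hi_mem_comp hne.symm h.symm).1

/-- The chain sum vanishes if its summand is invariant under the swaps moving `e`. -/
lemma chainSum_eq_zero_of_swap (ht : Function.Injective t) (hD : IsProperChain D) {e e' : E}
    (hne : e ≠ e') (h : Unsep D e e')
    (hG : ∀ D', IsProperChain D' → D ⊆ D' → D'.card + 2 = Fintype.card E →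
      ∀ b, b ≠ e → Unsep D' e b → G (insert (hi D' e) D') = G (insert (hi D' b) D')) :
    chainSum t D G = 0 := by
  have : Nonempty E := ⟨e⟩
  induction hk : Fintype.card E - D.card generalizing D e' with
  | zero => have := hD.card_lt; omega
  | succ k ih =>
  obtain ⟨hT, heT⟩ := hD.hi_mem_comp hne h
  have hT' := (mem_comp.1 hT).2
  have hcT := card_insert_of_mem_comp hT
  have hlt := hT'.card_lt
  by_cases hN : D.card + 2 = Fintype.card E
  · have hp := chainSum_pair (G := G) ht h
    have hhi : hi D e ≠ hi D e' := fun hh => heT (hh ▸ mem_insert_self _ _)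
    rw [comp_eq_pair hD hN hne h, sum_pair hhi,
      chainSum_of_mem_maxChains (insert_mem_maxChains hN hT),
      chainSum_of_mem_maxChains (insert_mem_maxChains hN (hD.hi_mem_comp hne.symm h.symm).1),
      hG D hD subset_rfl hN e' hne.symm h, if_pos self_mem_hi, if_neg heT,
      if_neg (hD.hi_mem_comp hne.symm h.symm).2, if_pos self_mem_hi] at hp
    have : t e - t e' ≠ 0 := sub_ne_zero.2 (ht.ne hne)
    have h0 : (t e - t e') * chainSum t D G = 0 := by rw [hp]; ring
    exact (mul_eq_zero.1 h0).resolve_left this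
  · obtain ⟨a, a', haa, hu⟩ := hT'.exists_unsep (by omega)
    have hiso : ∀ f, Unsep (insert (hi D e) D) e f → f = e := by
      intro f hf
      have h1 := (hf _ (mem_insert_self _ _)).1 (mem_insert_self _ _)
      rcases mem_insert.1 h1 with h1 | h1
      · exact h1
      · obtain ⟨S, hS, h2, h3⟩ := mem_lo.1 h1
        exact absurd ((hf S (mem_insert_of_mem hS)).2 h3) h2
    have hae : a ≠ e := by
      rintro rfl; exact haa (hiso a' hu).symm
    have hae' : a' ≠ e := by
      rintro rfl; exact haa (hiso a hu.symm)
    have huD : Unsep D a a' := fun S hS => hu S (mem_insert_of_mem hS)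
    have hp := chainSum_pair (G := G) ht huD
    rw [sum_eq_zero] at hp
    · exact (mul_eq_zero.1 hp).resolve_left (sub_ne_zero.2 (ht.ne haa))
    intro Q hQ
    by_cases hs : a ∈ Q ↔ a' ∈ Q
    · simp [hs]
    have hQ' := (mem_comp_iff hD).1 hQ
    suffices ∃ f, e ≠ f ∧ Unsep (insert Q D) e f by
      obtain ⟨f, hf, hfu⟩ := this
      rw [ih (mem_comp.1 hQ).2 hf hfu (fun D' h1 h2 => hG D' h1 ((subset_insert _ _).trans h2))
        (by rw [card_insert_of_mem_comp hQ]; omega), mul_zero]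
    have hQu : ∀ f, Unsep D e f → (e ∈ Q ↔ f ∈ Q) → Unsep (insert Q D) e f := by
      intro f h1 h2 S hS
      rcases mem_insert.1 hS with rfl | hS
      · exact h2
      · exact h1 S hS
    by_cases hea : Unsep D e a
    · have hea' : Unsep D e a' := fun S hS => (hea S hS).trans (huD S hS)
      by_cases h1 : e ∈ Q ↔ a ∈ Q
      · exact ⟨a, hae.symm, hQu a hea h1⟩
      · exact ⟨a', hae'.symm, hQu a' hea' (by tauto)⟩
    · refine ⟨e', hne, hQu e' h ?_⟩
      simp only [Unsep, not_forall] at hea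
      obtain ⟨S, hS, hSe⟩ := hea
      have h1 := huD S hS
      have h2 := h S hS
      exact mem_iff_of_subset_or (hQ'.2.2.2 S hS) h1 h2 hSe hs

end Swap

section Degree

variable {E X : Type*} [Fintype E] [DecidableEq E] [AddCommGroup X] [Module ℝ X]
  (t : E → ℝ) (v : E → X) (W : Submodule ℝ X)

/-- The span of `W` and the vectors indexed by `T`. -/
def clo (T : Finset E) : Submodule ℝ X := W ⊔ Submodule.span ℝ (v '' T)

open Classical in
/-- The indicator of `v e ∈ clo v W T`. -/
noncomputable def cle (e : E) (T : Finset E) : ℝ := if v e ∈ clo v W T then 1 else 0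

open Classical in
/-- The greedy basis of `v` modulo `W` with respect to the chain `ω`. -/
noncomputable def bas (ω : Finset (Finset E)) : Finset E :=
  univ.filter fun f => v f ∉ clo v W (lo ω f)

/-- The Lagrange weight of `f` in `B`. -/
noncomputable def lag (B : Finset E) (f : E) : ℝ := ∏ g ∈ B.erase f, (t f - t g)⁻¹

/-- The localized pushforward of `g` at the chain `ω`. -/
noncomputable def loc (g : Finset (Finset E) → E → ℝ) (ω : Finset (Finset E)) : ℝ :=
  ∑ f ∈ bas v W ω, lag t (bas v W ω) f * g ω f

/-- The degree functional. -/
noncomputable def deg (C : Finset (Finset E)) (g : Finset (Finset E) → E → ℝ) : ℝ :=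
  chainSum t C (loc t v W g)

/-- All greedy bases modulo `W` have `r` elements. -/
def HasRank (r : ℕ) : Prop := ∀ ω ∈ maxChains E, (bas v W ω).card = r

variable {t v W} {C D ω : Finset (Finset E)} {S T : Finset E} {a b e f : E}
  {g k : Finset (Finset E) → E → ℝ} {r : ℕ}

lemma exchange {x y : X} (h : x ∈ W ⊔ Submodule.span ℝ {y}) (hx : x ∉ W) :
    y ∈ W ⊔ Submodule.span ℝ {x} := by
  obtain ⟨w, hw, z, hz, rfl⟩ := Submodule.mem_sup.1 h
  obtain ⟨c, rfl⟩ := Submodule.mem_span_singleton.1 hz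
  have hc : c ≠ 0 := by
    rintro rfl
    simp [hw] at hx
  refine Submodule.mem_sup.2 ⟨-(c⁻¹ • w), W.neg_mem (W.smul_mem _ hw), c⁻¹ • (w + c • y),
    Submodule.smul_mem _ _ (Submodule.mem_span_singleton_self _), ?_⟩
  rw [smul_add, smul_smul, inv_mul_cancel₀ hc, one_smul, neg_add_cancel_left]

lemma clo_mono (h : S ⊆ T) : clo v W S ≤ clo v W T :=
  sup_le_sup_left (Submodule.span_mono (Set.image_mono (by exact_mod_cast h))) _

lemma mem_clo (h : e ∈ T) : v e ∈ clo v W T :=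
  Submodule.mem_sup_right (Submodule.subset_span ⟨e, by exact_mod_cast h, rfl⟩)

lemma clo_empty : clo v W ∅ = W := by simp [clo]

lemma clo_insert : clo v W (insert e T) = clo v W T ⊔ Submodule.span ℝ {v e} := by
  rw [clo, clo, coe_insert, Set.image_insert_eq, Set.insert_eq, Submodule.span_union, sup_assoc,
    sup_comm (Submodule.span ℝ {v e})]

lemma clo_sup (w : X) : clo v (W ⊔ Submodule.span ℝ {w}) T = clo v W T ⊔ Submodule.span ℝ {w} := by
  simp only [clo, sup_assoc, sup_comm (Submodule.span ℝ {w})]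

lemma sup_span_eq {w : X} (h : w ∈ W) : W ⊔ Submodule.span ℝ {w} = W :=
  sup_eq_left.2 ((Submodule.span_singleton_le_iff_mem _ _).2 h)

lemma cle_of_mem (h : e ∈ T) : cle v W e T = 1 := if_pos (mem_clo h)

lemma cle_univ : cle v W e univ = 1 := cle_of_mem (mem_univ e)

lemma cle_empty (he : v e ∉ W) : cle v W e ∅ = 0 := if_neg (by rwa [clo_empty])

lemma cle_nonneg : 0 ≤ cle v W e T := by unfold cle; split_ifs <;> norm_num

lemma mem_bas : f ∈ bas v W ω ↔ v f ∉ clo v W (lo ω f) := by simp [bas]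

lemma exists_jump (hω : ω ∈ maxChains E) (he : v e ∉ W) :
    ∃ j, v e ∉ clo v W (lo ω j) ∧ v e ∈ clo v W (hi ω j) := by
  classical
  obtain ⟨T, hT, hmax⟩ := exists_max_image ((insert ∅ ω).filter fun T => v e ∉ clo v W T) card
    ⟨∅, by simp [clo_empty, he]⟩
  rw [mem_filter, mem_insert] at hT
  obtain ⟨j, hj⟩ := exists_lo_eq hω hT.1.symm
  refine ⟨j, hj ▸ hT.2, ?_⟩
  rcases hi_mem hω j with h | h
  · by_contra hcon
    have := hmax (hi ω j) (by simp [h, hcon])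
    rw [hi, card_insert_of_notMem notMem_lo, hj] at this
    omega
  · rw [h]; exact mem_clo (mem_univ e)

lemma bas_contract (hω : ω ∈ maxChains E) (he : v e ∉ W) :
    ∃ j ∈ bas v W ω, bas v (W ⊔ Submodule.span ℝ {v e}) ω = (bas v W ω).erase j ∧
      lin t ω (cle v W e) = t j := by
  obtain ⟨j, hj, hj'⟩ := exists_jump hω he
  refine ⟨j, ?_, ?_, ?_⟩
  · rw [mem_bas]
    intro h
    rw [hi, clo_insert, sup_span_eq h] at hj'
    exact hj hj'
  · ext f
    rw [mem_erase, mem_bas, mem_bas, clo_sup]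
    by_cases hf : f = j
    · subst hf
      simp only [ne_eq, not_true, false_and, iff_false, not_not]
      rw [hi, clo_insert] at hj'
      exact exchange hj' hj
    · simp only [ne_eq, hf, not_false_eq_true, true_and, not_iff_not]
      rcases hi_subset_lo_or hω hf with h | h
      · constructor
        · intro h1
          by_contra h2
          have := exchange h1 h2
          rw [← clo_insert] at this
          exact hj (clo_mono h this)
        · exact fun h => Submodule.mem_sup_left h
      · rw [sup_span_eq (clo_mono h hj')]
  · rw [lin_apply, sum_eq_single j]
    · simp [cle, hj, hj']
    · intro f _ hf
      rcases hi_subset_lo_or hω hf with h | h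
      · have h1 : v e ∉ clo v W (hi ω f) := fun h1 => hj (clo_mono h h1)
        have h2 : v e ∉ clo v W (lo ω f) := fun h2 => h1 (clo_mono (subset_insert _ _) h2)
        simp [cle, h1, h2]
      · have h1 : v e ∈ clo v W (lo ω f) := clo_mono h hj'
        have h2 : v e ∈ clo v W (hi ω f) := clo_mono (subset_insert _ _) h1
        simp [cle, h1, h2]
    · simp

lemma HasRank.contract (h : HasRank v W (r + 1)) (he : v e ∉ W) :
    HasRank v (W ⊔ Submodule.span ℝ {v e}) r := by
  intro ω hω
  obtain ⟨j, hj, h', -⟩ := bas_contract (t := fun _ => 0) hω he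
  rw [h', card_erase_of_mem hj, h ω hω, Nat.add_sub_cancel]

lemma loc_congr (h : ∀ f ∈ bas v W ω, g ω f = k ω f) : loc t v W g ω = loc t v W k ω :=
  sum_congr rfl fun f hf => by rw [h f hf]

lemma loc_contract (ht : Function.Injective t) (hω : ω ∈ maxChains E) (he : v e ∉ W) :
    loc t v (W ⊔ Submodule.span ℝ {v e}) g ω =
      loc t v W (fun ω f => g ω f * (t f - lin t ω (cle v W e))) ω := by
  obtain ⟨j, hj, h1, h2⟩ := bas_contract (t := t) hω he
  rw [loc, loc, h1, ← add_sum_erase _ _ hj, h2, sub_self, mul_zero, mul_zero, zero_add]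
  refine sum_congr rfl fun f hf => ?_
  have hfj := (mem_erase.1 hf).1
  have : lag t (bas v W ω) f = lag t ((bas v W ω).erase j) f * (t f - t j)⁻¹ := by
    rw [lag, lag, erase_right_comm, mul_comm, mul_prod_erase ((bas v W ω).erase f)
      (fun g => (t f - t g)⁻¹) (mem_erase.2 ⟨hfj.symm, hj⟩)]
  rw [this]
  have : t f - t j ≠ 0 := sub_ne_zero.2 (ht.ne hfj)
  field_simp

lemma loc_mul_left (c : Finset (Finset E) → ℝ) :
    loc t v W (fun ω f => g ω f * c ω) ω = loc t v W g ω * c ω := by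
  simp only [loc, sum_mul, mul_assoc]

lemma deg_congr (h : ∀ ω ∈ maxChains E, C ⊆ ω → ∀ f ∈ bas v W ω, g ω f = k ω f) :
    deg t v W C g = deg t v W C k :=
  chainSum_congr fun ω hω hC => loc_congr (h ω hω hC)

lemma deg_contract (ht : Function.Injective t) (he : v e ∉ W) :
    deg t v W C (fun ω f => g ω f * (t f - lin t ω (cle v W e))) =
      deg t v (W ⊔ Submodule.span ℝ {v e}) C g :=
  chainSum_congr fun _ hω _ => (loc_contract ht hω he).symm

lemma deg_add : deg t v W C (fun ω f => g ω f + k ω f) = deg t v W C g + deg t v W C k := by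
  rw [deg, deg, deg, ← map_add]
  refine chainSum_congr fun ω _ _ => ?_
  simp only [loc, Pi.add_apply, mul_add, sum_add_distrib]

lemma deg_mul_const (c : ℝ) : deg t v W C (fun ω f => g ω f * c) = deg t v W C g * c := by
  rw [deg, deg, mul_comm, ← smul_eq_mul, ← map_smul]
  refine chainSum_congr fun ω _ _ => ?_
  rw [loc_mul_left (fun _ => c), Pi.smul_apply, smul_eq_mul, mul_comm]

lemma deg_mul_lin (ht : Function.Injective t) {x : Finset E → ℝ} (hx : ∀ T ∈ C, x T = 0)
    (h0 : x ∅ = 0) (h1 : x univ = 0) :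
    deg t v W C (fun ω f => g ω f * lin t ω x) =
      ∑ T ∈ comp C, x T * deg t v W (insert T C) g := by
  simp only [deg]
  rw [← chainSum_mul_lin ht hx h0 h1]
  exact chainSum_congr fun ω _ _ => loc_mul_left fun ω => lin t ω x

lemma HasRank.deg_eq_zero (h : HasRank v W 0) : deg t v W C g = 0 := by
  rw [deg, chainSum_congr (H := 0), map_zero]
  intro ω hω _
  simp [loc, card_eq_zero.1 (h ω hω)]

lemma sum_lag_eq_zero (ht : Function.Injective t) {B : Finset E} (hB : 2 ≤ B.card) :
    ∑ f ∈ B, lag t B f = 0 := by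
  have h := Lagrange.coeff_eq_sum (P := (1 : Polynomial ℝ)) (ht.injOn (s := B))
    (by rw [Polynomial.degree_one]; exact_mod_cast (by omega : 0 < B.card))
  rw [Polynomial.coeff_one, if_neg (by omega)] at h
  rw [h]
  refine sum_congr rfl fun f _ => ?_
  rw [lag, prod_inv_distrib, Polynomial.eval_one, one_div]

lemma HasRank.loc_one (h : HasRank v W 1) (hω : ω ∈ maxChains E) :
    loc t v W (fun _ _ => 1) ω = 1 := by
  obtain ⟨f, hf⟩ := card_eq_one.1 (h ω hω)
  simp [loc, hf, lag]

lemma deg_one_eq_zero (ht : Function.Injective t) (hC : IsProperChain C) (h : HasRank v W r)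
    (hr : 1 ≤ r) (hd : C.card + 2 < Fintype.card E + r) : deg t v W C (fun _ _ => 1) = 0 := by
  obtain rfl | hr := hr.eq_or_lt
  · obtain ⟨a, b, hab, hu⟩ := hC.exists_unsep (by omega)
    rw [deg, chainSum_congr (H := fun _ => 1) (fun ω hω _ => h.loc_one hω)]
    exact chainSum_eq_zero_of_swap ht hC hab hu fun _ _ _ _ _ _ _ => rfl
  · rw [deg, chainSum_congr (H := 0), map_zero]
    intro ω hω _
    simp only [loc, mul_one]
    exact sum_lag_eq_zero ht (by rw [h ω hω]; exact hr)

end Degree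

section Mixed

variable {E X : Type*} [Fintype E] [DecidableEq E] [AddCommGroup X] [Module ℝ X]
  (t : E → ℝ) (v : E → X) (W : Submodule ℝ X)

/-- The linear form attached to `u`. -/
noncomputable def ell (u : (Finset E → ℝ) × ℝ) (ω : Finset (Finset E)) (f : E) : ℝ :=
  lin t ω u.1 + u.2 * t f

/-- The mixed degree of a list of linear forms. -/
noncomputable def mix (C : Finset (Finset E)) (ws : List ((Finset E → ℝ) × ℝ)) : ℝ :=
  deg t v W C fun ω f => (ws.map fun w => ell t w ω f).prod

/-- `x` agrees with the modular function `modular c l` on `C`, `∅` and `univ`. -/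
def Interpolates (C : Finset (Finset E)) (x : Finset E → ℝ) (c : ℝ) (l : E → ℝ) : Prop :=
  (∀ T ∈ C, x T = modular c l T) ∧ x ∅ = modular c l ∅ ∧ x univ = modular c l univ

/-- On each proper chain, `x` is interpolated by a modular function bounding it from below. -/
def Nef (x : Finset E → ℝ) : Prop :=
  ∀ C, IsProperChain C → ∃ c l, Interpolates C x c l ∧ ∀ T, modular c l T ≤ x T

/-- The strict version of `Nef`. -/
def Amp (x : Finset E → ℝ) : Prop :=
  ∀ C, IsProperChain C → ∃ c l, Interpolates C x c l ∧
    ∀ T, T ∉ C → T ≠ ∅ → T ≠ univ → modular c l T < x T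

/-- The cone of ample classes. -/
def Ample (u : (Finset E → ℝ) × ℝ) : Prop := Amp u.1 ∧ 0 < u.2

variable {t v W} {C D ω : Finset (Finset E)} {S T : Finset E} {a b e f : E}
  {g k : Finset (Finset E) → E → ℝ} {r : ℕ} {u w : (Finset E → ℝ) × ℝ}
  {ws : List ((Finset E → ℝ) × ℝ)} {x y : Finset E → ℝ} {c : ℝ} {l : E → ℝ}

lemma exists_interpolates (hC : IsProperChain C) [Nonempty E] (x : Finset E → ℝ) :
    ∃ c l, Interpolates C x c l := by
  obtain ⟨ω, hω, hCω⟩ := hC.exists_maxChain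
  have key : ∀ k, ∀ T : Finset E, T.card = k → T ∈ ω ∨ T = ∅ ∨ T = univ →
      x T = modular (x ∅) (fun e => x (hi ω e) - x (lo ω e)) T := by
    intro k
    induction k with
    | zero =>
      intro T hT _
      rw [card_eq_zero.1 hT]
      simp [modular]
    | succ k ih =>
      intro T hT hT'
      have hne : T ≠ ∅ := by rintro rfl; simp at hT
      obtain ⟨a, rfl⟩ := exists_hi_eq hω (T := T) (by tauto)
      have h1 : (lo ω a).card = k := by
        rw [hi, card_insert_of_notMem notMem_lo] at hT; omega
      have h2 := ih (lo ω a) h1 (by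
        rcases (mem_maxChains.1 hω).1.lo_mem a with h | h <;> simp [h])
      have h3 : ∀ F : E → ℝ, ∑ e ∈ hi ω a, F e = F a + ∑ e ∈ lo ω a, F e := fun F =>
        sum_insert notMem_lo
      rw [modular] at h2 ⊢
      rw [h3]
      linarith
  exact ⟨_, _, fun T hT => key _ T rfl (Or.inl (hCω hT)), key _ _ rfl (by simp),
    key _ _ rfl (by simp)⟩

lemma exists_generic (hC : IsProperChain C) [Nonempty E] (h : HasRank v W (r + 1)) :
    ∃ e, v e ∉ W ∧ ∀ S ∈ C, v e ∈ clo v W S → e ∈ S := by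
  obtain ⟨ω, hω, hCω⟩ := hC.exists_maxChain
  obtain ⟨e, he⟩ := card_pos.1 (by rw [h ω hω]; omega : 0 < (bas v W ω).card)
  rw [mem_bas] at he
  refine ⟨e, fun hW => he (Submodule.mem_sup_left hW), fun S hS heS => ?_⟩
  by_contra hcon
  exact he (clo_mono (subset_lo (hCω hS) hcon) heS)

/-- The coefficient of the divisor of `T` in the decomposition of `u`. -/
noncomputable def coef (v : E → X) (W : Submodule ℝ X) (e : E) (c : ℝ) (l : E → ℝ)
    (u : (Finset E → ℝ) × ℝ) (T : Finset E) : ℝ :=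
  u.1 T + u.2 * (cle v W e T - if e ∈ T then 1 else 0) - modular c l T

lemma sum_single_mul : ∑ i, (Pi.single e 1 : E → ℝ) i * t i = t e := by
  simp [Pi.single_apply]

lemma deg_mul_ell (ht : Function.Injective t) (he : v e ∉ W)
    (heC : ∀ S ∈ C, v e ∈ clo v W S → e ∈ S) (hx : Interpolates C u.1 c l) :
    deg t v W C (fun ω f => g ω f * ell t u ω f) =
      (∑ i, l i * t i + u.2 * t e) * deg t v W C g +
      u.2 * deg t v (W ⊔ Submodule.span ℝ {v e}) C g +
      ∑ T ∈ comp C, coef v W e c l u T * deg t v W (insert T C) g := by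
  have hm : ∀ T : Finset E, modular 0 (Pi.single e 1 : E → ℝ) T = if e ∈ T then 1 else 0 := by
    intro T; simp [modular, Pi.single_apply]
  rw [← deg_contract ht he, ← deg_mul_lin ht,
    mul_comm (_ + _), mul_comm u.2 (deg _ _ _ _ _), ← deg_mul_const,
    ← deg_mul_const, ← deg_add, ← deg_add]
  · refine deg_congr fun ω _ _ f _ => ?_
    have : coef v W e c l u = u.1 + u.2 • (cle v W e - modular 0 (Pi.single e 1 : E → ℝ))
        - modular c l := by
      funext T
      simp [coef, hm]
    rw [this]
    simp only [map_add, map_sub, map_smul, lin_modular, ell, smul_eq_mul, sum_single_mul]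
    ring
  · intro T hT
    rw [coef, hx.1 T hT]
    by_cases h : e ∈ T
    · simp [h, cle_of_mem h]
    · have : v e ∉ clo v W T := fun hh => h (heC T hT hh)
      simp [h, cle, this]
  · simp [coef, hx.2.1, cle_empty he]
  · simp [coef, hx.2.2, cle_univ]

lemma mix_cons : mix t v W C (u :: ws) =
    deg t v W C (fun ω f => (ws.map fun w => ell t w ω f).prod * ell t u ω f) :=
  deg_congr fun _ _ _ _ _ => by rw [List.map_cons, List.prod_cons, mul_comm]

lemma mix_perm {ws' : List ((Finset E → ℝ) × ℝ)} (h : ws.Perm ws') :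
    mix t v W C ws = mix t v W C ws' :=
  deg_congr fun _ _ _ _ _ => (h.map _).prod_eq

lemma mix_eq_zero (ht : Function.Injective t) [Nonempty E] (hC : IsProperChain C)
    (h : HasRank v W r) (hd : C.card + ws.length + 2 < Fintype.card E + r) :
    mix t v W C ws = 0 := by
  induction ws generalizing C W r with
  | nil =>
    rcases r with _ | r
    · exact h.deg_eq_zero
    · simpa [mix] using deg_one_eq_zero ht hC h (by omega) (by simpa using hd)
  | cons u ws ih =>
    rcases r with _ | r
    · exact h.deg_eq_zero
    rw [List.length_cons] at hd
    obtain ⟨e, he, heC⟩ := exists_generic hC h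
    obtain ⟨c, l, hx⟩ := exists_interpolates hC u.1
    rw [mix_cons, deg_mul_ell ht he heC hx]
    have h1 := ih hC h (by omega)
    have h2 := ih hC (h.contract he) (by omega)
    simp only [mix] at h1 h2
    rw [h1, h2, mul_zero, mul_zero, add_zero, zero_add]
    · refine sum_eq_zero fun T hT => ?_
      have h3 := ih (mem_comp.1 hT).2 h (by rw [card_insert_of_mem_comp hT]; omega)
      simp only [mix] at h3
      rw [h3, mul_zero]

lemma mix_cons_eq (ht : Function.Injective t) [Nonempty E] (hC : IsProperChain C)
    (h : HasRank v W r) (hd : C.card + ws.length + 2 < Fintype.card E + r) (he : v e ∉ W)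
    (heC : ∀ S ∈ C, v e ∈ clo v W S → e ∈ S) (hx : Interpolates C u.1 c l) :
    mix t v W C (u :: ws) = u.2 * mix t v (W ⊔ Submodule.span ℝ {v e}) C ws +
      ∑ T ∈ comp C, coef v W e c l u T * mix t v W (insert T C) ws := by
  have h0 := mix_eq_zero ht hC h hd
  rw [mix_cons, deg_mul_ell ht he heC hx]
  simp only [mix] at h0 ⊢
  rw [h0, mul_zero, zero_add]

lemma coef_pos (hu : 0 < u.2) (h : ∀ T, T ∉ C → T ≠ ∅ → T ≠ univ → modular c l T < u.1 T)
    (hT : T ∈ comp C) : 0 < coef v W e c l u T := by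
  obtain ⟨h1, h2⟩ := mem_comp.1 hT
  obtain ⟨-, h3, h4, -⟩ := isProperChain_insert.1 h2
  have h5 := h T h1 h3 h4
  have h6 : (if e ∈ T then (1 : ℝ) else 0) ≤ cle v W e T := by
    split_ifs with h
    · rw [cle_of_mem h]
    · exact cle_nonneg
  have := mul_nonneg hu.le (sub_nonneg.2 h6)
  rw [coef]
  linarith

lemma comp_nonempty (hC : IsProperChain C) (h : C.card + 1 < Fintype.card E) :
    (comp C).Nonempty := by
  obtain ⟨a, b, hab, hu⟩ := hC.exists_unsep h
  exact ⟨_, (hC.hi_mem_comp hab hu).1⟩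

lemma mix_pos (ht : Function.Injective t) [Nonempty E] (hC : IsProperChain C)
    (h : HasRank v W r) (hr : 1 ≤ r) (hd : C.card + ws.length + 2 = Fintype.card E + r)
    (hws : ∀ w ∈ ws, Ample w) : 0 < mix t v W C ws := by
  induction ws generalizing C W r with
  | nil =>
    have := hC.card_lt
    obtain rfl : r = 1 := by simp at hd; omega
    have hm : C ∈ maxChains E := mem_maxChains.2 ⟨hC, by simp at hd; omega⟩
    simp [mix, deg, chainSum_of_mem_maxChains hm, h.loc_one hm]
  | cons u ws ih =>
    obtain ⟨r, rfl⟩ := Nat.exists_eq_add_of_le' hr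
    rw [List.length_cons] at hd
    obtain ⟨e, he, heC⟩ := exists_generic hC h
    have hu := hws u (by simp)
    obtain ⟨c, l, hx, hx'⟩ := hu.1 C hC
    rw [mix_cons_eq ht hC h (by omega) he heC hx]
    have hws' : ∀ w ∈ ws, Ample w := fun w hw => hws w (by simp [hw])
    have hsum : ∀ T ∈ comp C, 0 < coef v W e c l u T * mix t v W (insert T C) ws := fun T hT =>
      mul_pos (coef_pos hu.2 hx' hT) (ih (mem_comp.1 hT).2 h (by omega)
        (by rw [card_insert_of_mem_comp hT]; omega) hws')
    rcases r with _ | r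
    · have h0 : mix t v (W ⊔ Submodule.span ℝ {v e}) C ws = 0 := (h.contract he).deg_eq_zero
      rw [h0, mul_zero, zero_add]
      exact sum_pos hsum (comp_nonempty hC (by omega))
    · exact add_pos_of_pos_of_nonneg
        (mul_pos hu.2 (ih hC (h.contract he) (by omega) (by omega) hws'))
        (sum_nonneg fun T hT => (hsum T hT).le)

lemma ell_add : ell t (u + w) ω f = ell t u ω f + ell t w ω f := by
  simp [ell]; ring

lemma ell_smul : ell t (c • u) ω f = c * ell t u ω f := by
  simp [ell]; ring

lemma mix_cons_add : mix t v W C ((u + w) :: ws) = mix t v W C (u :: ws) +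
    mix t v W C (w :: ws) := by
  simp only [mix_cons, ell_add, mul_add, deg_add]

lemma mix_cons_smul : mix t v W C ((c • u) :: ws) = c * mix t v W C (u :: ws) := by
  rw [mul_comm]
  simp only [mix_cons, ell_smul, ← deg_mul_const]
  exact deg_congr fun _ _ _ _ _ => by ring

lemma mix_swap {u u' : (Finset E → ℝ) × ℝ} :
    mix t v W C (u :: u' :: ws) = mix t v W C (u' :: u :: ws) := mix_perm (List.Perm.swap _ _ _)

lemma mix_ind (ht : Function.Injective t) (hT : T ∈ comp C) :
    mix t v W C ((ind T, 0) :: ws) = mix t v W (insert T C) ws := by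
  obtain ⟨h1, h2⟩ := mem_comp.1 hT
  obtain ⟨-, h3, h4, -⟩ := isProperChain_insert.1 h2
  have : mix t v W C ((ind T, 0) :: ws) =
      deg t v W C (fun ω f => (ws.map fun w => ell t w ω f).prod * lin t ω (ind T)) := by
    rw [mix_cons]; simp [ell]
  rw [this, deg_mul_lin ht]
  · rw [sum_eq_single T]
    · simp [ind, mix]
    · intro S _ hS; simp [ind, hS]
    · exact fun h => absurd hT h
  · intro S hS
    have : S ≠ T := by rintro rfl; exact h1 hS
    simp [ind, this]
  · simp [ind, h3.symm]
  · simp [ind, h4.symm]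

lemma mix_contract (ht : Function.Injective t) (he : v e ∉ W) :
    mix t v W C ((-cle v W e, 1) :: ws) = mix t v (W ⊔ Submodule.span ℝ {v e}) C ws := by
  rw [mix_cons, mix, ← deg_contract ht he]
  refine deg_congr fun _ _ _ _ _ => ?_
  simp only [ell, map_neg]
  ring

end Mixed

section Bochner

open scoped InnerProductSpace

lemma inner_nonpos_of_orthogonal {F : Type*} [NormedAddCommGroup F] [InnerProductSpace ℝ F]
    [FiniteDimensional ℝ F] {T : F →ₗ[ℝ] F} (hT : T.IsSymmetric) {c z : F}
    (h1 : ∀ x, ⟪T x, x⟫_ℝ ≤ ⟪T x, T x⟫_ℝ) (h2 : ∀ x, ⟪T x, x⟫_ℝ ≤ ⟪x, x⟫_ℝ)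
    (h3 : ∀ x, ⟪T x, x⟫_ℝ = ⟪x, x⟫_ℝ → ∃ a : ℝ, x = a • c) (hz : ⟪z, c⟫_ℝ = 0) :
    ⟪T z, z⟫_ℝ ≤ 0 := by
  set b := hT.eigenvectorBasis rfl
  rw [← b.sum_inner_mul_inner]
  refine sum_nonpos fun i _ => ?_
  set m := hT.eigenvalues rfl i
  have hb : T (b i) = m • b i := hT.apply_eigenvectorBasis rfl i
  have hbb : ⟪b i, b i⟫_ℝ = 1 := by
    rw [real_inner_self_eq_norm_sq, b.norm_eq_one]; norm_num
  rw [hT z (b i), hb, real_inner_smul_right, real_inner_comm z (b i)]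
  have e1 := h1 (b i)
  have e2 := h2 (b i)
  have e3 := h3 (b i)
  rw [hb, real_inner_smul_left, real_inner_smul_right, real_inner_smul_left, hbb] at e1
  rw [hb, real_inner_smul_left, hbb] at e2 e3
  by_cases hm : m = 1
  · obtain ⟨a, ha⟩ := e3 (by rw [hm]; ring)
    have : ⟪z, b i⟫_ℝ = 0 := by rw [ha, real_inner_smul_right, hz, mul_zero]
    rw [this]; simp
  · have hm1 : m < 1 := lt_of_le_of_ne (by linarith) hm
    have hm0 : m ≤ 0 := by nlinarith
    have := mul_self_nonneg ⟪z, b i⟫_ℝ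
    nlinarith

lemma hyperbolic_of_bochner {ι : Type*} [Fintype ι] (A : ι → ι → ℝ) (c p : ι → ℝ)
    (hA : ∀ i j, A i j = A j i) (hc : ∀ i, 0 < c i) (hoff : ∀ i j, i ≠ j → 0 ≤ A i j)
    (hp : ∀ i, p i = ∑ j, A i j * c j) (hp0 : ∀ i, 0 < p i)
    (hconn : ∀ φ : ι → ℝ, (∀ i j, i ≠ j → 0 < A i j → φ i = φ j) → ∃ a, ∀ i, φ i = a)
    (hB : ∀ u : ι → ℝ, ∑ i, u i * ∑ j, A i j * u j ≤ ∑ i, c i * (∑ j, A i j * u j) ^ 2 / p i)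
    (u : ι → ℝ) :
    (∑ i, u i * ∑ j, A i j * u j) * (∑ i, c i * ∑ j, A i j * c j) ≤
      (∑ i, u i * ∑ j, A i j * c j) ^ 2 := by
  classical
  set q : ι → ℝ := fun i => √(p i / c i)
  have hq : ∀ i, 0 < q i := fun i => Real.sqrt_pos.2 (div_pos (hp0 i) (hc i))
  have hq2 : ∀ i, q i * q i * c i = p i := fun i => by
    rw [Real.mul_self_sqrt (div_pos (hp0 i) (hc i)).le, div_mul_cancel₀ _ (hc i).ne']
  set M : Matrix ι ι ℝ := fun i j => A i j / (q i * q j)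
  have hM : M.IsHermitian := by
    ext i j
    rw [Matrix.conjTranspose_apply, star_trivial]
    simp only [M]
    rw [hA i j, mul_comm]
  set T := Matrix.toEuclideanLin M
  have hT : T.IsSymmetric := Matrix.isSymmetric_toEuclideanLin_iff.2 hM
  let s : (ι → ℝ) → EuclideanSpace ℝ ι := fun y => WithLp.toLp 2 fun i => q i * y i
  have hTs : ∀ y i, T (s y) i = (∑ j, A i j * y j) / q i := by
    intro y i
    simp only [T, s, Matrix.toLpLin_apply, Matrix.mulVec, dotProduct]
    rw [sum_div]
    refine sum_congr rfl fun j _ => ?_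
    have := (hq i).ne'
    have := (hq j).ne'
    simp only [M]
    field_simp
  have hsurj : ∀ x, ∃ y, x = s y := fun x => ⟨fun i => x i / q i, by
    ext i
    have := (hq i).ne'
    simp only [s]
    field_simp⟩
  have in1 : ∀ y z, ⟪T (s y), s z⟫_ℝ = ∑ i, z i * ∑ j, A i j * y j := by
    intro y z
    rw [PiLp.inner_apply]
    refine sum_congr rfl fun i _ => ?_
    rw [hTs]
    have := (hq i).ne'
    simp only [s, RCLike.inner_apply, conj_trivial]
    field_simp
  have in2 : ∀ y, ⟪T (s y), T (s y)⟫_ℝ = ∑ i, c i * (∑ j, A i j * y j) ^ 2 / p i := by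
    intro y
    rw [PiLp.inner_apply]
    refine sum_congr rfl fun i _ => ?_
    rw [hTs, ← hq2]
    have := (hq i).ne'
    have := (hc i).ne'
    simp only [RCLike.inner_apply, conj_trivial]
    field_simp
  have hTc : T (s c) = s c := by
    ext i
    rw [hTs, ← hp, ← hq2]
    have := (hq i).ne'
    simp only [s]
    field_simp
  have in3 : ∀ φ : ι → ℝ, ⟪s (fun i => c i * φ i), s (fun i => c i * φ i)⟫_ℝ -
      ⟪T (s (fun i => c i * φ i)), s (fun i => c i * φ i)⟫_ℝ =
      (∑ i, ∑ j, A i j * c i * c j * (φ i - φ j) ^ 2) / 2 := by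
    intro φ
    have h1 : ⟪s (fun i => c i * φ i), s (fun i => c i * φ i)⟫_ℝ =
        ∑ i, ∑ j, A i j * c i * c j * φ i ^ 2 := by
      rw [PiLp.inner_apply]
      refine sum_congr rfl fun i _ => ?_
      simp only [s, RCLike.inner_apply, conj_trivial]
      calc _ = (q i * q i * c i) * (c i * φ i ^ 2) := by ring
        _ = _ := by
          rw [hq2, hp, sum_mul]
          exact sum_congr rfl fun j _ => by ring
    have h2 : ∑ i, ∑ j, A i j * c i * c j * φ i ^ 2 = ∑ i, ∑ j, A i j * c i * c j * φ j ^ 2 := by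
      rw [sum_comm]
      refine sum_congr rfl fun i _ => sum_congr rfl fun j _ => ?_
      rw [hA j i]; ring
    have h3 : ⟪T (s (fun i => c i * φ i)), s (fun i => c i * φ i)⟫_ℝ =
        ∑ i, ∑ j, A i j * c i * c j * (φ i * φ j) := by
      rw [in1]
      refine sum_congr rfl fun i _ => ?_
      rw [mul_sum]
      exact sum_congr rfl fun j _ => by ring
    have h4 : ∑ i, ∑ j, A i j * c i * c j * (φ i - φ j) ^ 2 =
        ∑ i, ∑ j, A i j * c i * c j * φ i ^ 2 + ∑ i, ∑ j, A i j * c i * c j * φ j ^ 2 -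
          2 * ∑ i, ∑ j, A i j * c i * c j * (φ i * φ j) := by
      simp only [mul_sum, ← sum_add_distrib, ← sum_sub_distrib]
      exact sum_congr rfl fun i _ => sum_congr rfl fun j _ => by ring
    rw [h1, h3, h4, ← h2]
    ring
  have hsurj' : ∀ x, ∃ φ : ι → ℝ, x = s (fun i => c i * φ i) := fun x => by
    obtain ⟨y, rfl⟩ := hsurj x
    exact ⟨fun i => y i / c i, by congr; funext i; have := (hc i).ne'; field_simp⟩
  have hnn : ∀ (φ : ι → ℝ) (i j : ι), 0 ≤ A i j * c i * c j * (φ i - φ j) ^ 2 := by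
    intro φ i j
    by_cases hij : i = j
    · simp [hij]
    · have := hoff i j hij
      have := hc i
      have := hc j
      positivity
  have key := fun z => inner_nonpos_of_orthogonal (c := s c) (z := z) hT
    (fun x => by obtain ⟨y, rfl⟩ := hsurj x; rw [in1, in2]; exact hB y)
    (fun x => by
      obtain ⟨φ, rfl⟩ := hsurj' x
      rw [← sub_nonneg, in3]
      exact div_nonneg (sum_nonneg fun i _ => sum_nonneg fun j _ => hnn φ i j) (by norm_num))
    (fun x hx => by
      obtain ⟨φ, rfl⟩ := hsurj' x
      have h0 := in3 φ
      rw [hx, sub_self, eq_comm, div_eq_zero_iff, or_iff_left (by norm_num),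
        sum_eq_zero_iff_of_nonneg (fun i _ => sum_nonneg fun j _ => hnn φ i j)] at h0
      obtain ⟨a, ha⟩ := hconn φ fun i j hij hAij => by
        have h1 := h0 i (mem_univ i)
        rw [sum_eq_zero_iff_of_nonneg (fun j _ => hnn φ i j)] at h1
        have h2 := h1 j (mem_univ j)
        have h3 : A i j * c i * c j ≠ 0 := by
          have := hc i
          have := hc j
          positivity
        have h4 := (mul_eq_zero.1 h2).resolve_left h3
        exact sub_eq_zero.1 (pow_eq_zero_iff two_ne_zero |>.1 h4)
      refine ⟨a, ?_⟩
      ext i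
      simp only [s, ha i, PiLp.smul_apply, smul_eq_mul]
      ring)
  rw [← in1 u u, ← in1 c c, ← in1 c u, hTc]
  set K := ⟪s c, s c⟫_ℝ with hK
  set σ := ⟪s c, s u⟫_ℝ with hσ
  have hσ' : ⟪s u, s c⟫_ℝ = σ := real_inner_comm _ _
  have hK0 : 0 ≤ K := real_inner_self_nonneg
  rcases hK0.eq_or_lt with h0 | h0
  · rw [← h0, mul_zero]; positivity
  have hz := key (K • s u - σ • s c) (by
    rw [inner_sub_left, real_inner_smul_left, real_inner_smul_left, hσ', ← hK]; ring)
  have hTu : ⟪T (s u), s c⟫_ℝ = σ := by rw [hT, hTc, hσ']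
  simp only [map_sub, map_smul, hTc, inner_sub_left, inner_sub_right, real_inner_smul_left,
    real_inner_smul_right, hTu, ← hK, ← hσ] at hz
  have : K * (⟪T (s u), s u⟫_ℝ * K - σ ^ 2) ≤ 0 := by linarith
  have := nonpos_of_mul_nonpos_right this h0
  linarith

end Bochner

section Hyperbolic

variable {V : Type*} [AddCommGroup V] [Module ℝ V]

lemma hyperbolic_of_functional (Q : V →ₗ[ℝ] V →ₗ[ℝ] ℝ) (hQ : ∀ u w, Q u w = Q w u)
    (α : V →ₗ[ℝ] ℝ) (hα : ∀ z, α z = 0 → Q z z ≤ 0) {w : V} (hw : 0 < Q w w) (u : V) :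
    Q u u * Q w w ≤ Q u w ^ 2 := by
  have hαw : α w ≠ 0 := fun h => (hα w h).not_gt hw
  have h := hα (α w • u - α u • w) (by simp [mul_comm])
  simp only [map_sub, map_smul, LinearMap.sub_apply, LinearMap.smul_apply, smul_eq_mul,
    hQ w u] at h
  have h1 : 0 < α w ^ 2 := by positivity
  have h2 : α w ^ 2 * (Q u u * Q w w - Q u w ^ 2) ≤ 0 := by
    nlinarith [sq_nonneg (α w * Q u w - α u * Q w w), mul_nonneg hw.le (neg_nonneg.2 h)]
  have := nonpos_of_mul_nonpos_right h2 h1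
  linarith

lemma hyperbolic_transfer (Q : V →ₗ[ℝ] V →ₗ[ℝ] ℝ) (hQ : ∀ u w, Q u w = Q w u) {w₀ : V}
    (hw₀ : 0 < Q w₀ w₀) (h₀ : ∀ u, Q u u * Q w₀ w₀ ≤ Q u w₀ ^ 2) {w : V} (hw : 0 < Q w w)
    (u : V) : Q u u * Q w w ≤ Q u w ^ 2 := by
  refine hyperbolic_of_functional Q hQ (Q w₀) (fun z hz => ?_) hw u
  have h := h₀ z
  rw [hQ z w₀, hz] at h
  by_contra! hcon
  nlinarith [mul_pos hcon hw₀]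

lemma hyperbolic_step {ι : Type*} [Fintype ι] (Q : V →ₗ[ℝ] V →ₗ[ℝ] ℝ) (hQ : ∀ u w, Q u w = Q w u)
    (D : ι → V) (κ : V → ι → ℝ) (hκ : ∀ u z, Q u z = ∑ i, κ u i * Q (D i) z)
    (R : ι → V → V → ℝ) (w : V) (hκw : ∀ i, 0 < κ w i) (hR : ∀ i u, R i u w = Q (D i) u)
    (hRw : ∀ i, 0 < R i w w) (hRR : ∀ i u, R i u u * R i w w ≤ R i u w ^ 2)
    (hsum : ∀ u, Q u u = ∑ i, κ w i * R i u u) (hoff : ∀ i j, i ≠ j → 0 ≤ Q (D i) (D j))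
    (hconn : ∀ φ : ι → ℝ, (∀ i j, i ≠ j → 0 < Q (D i) (D j) → φ i = φ j) → ∃ a, ∀ i, φ i = a)
    (u : V) : Q u u * Q w w ≤ Q u w ^ 2 := by
  have hD : ∀ (x : ι → ℝ) i, Q (D i) (∑ j, x j • D j) = ∑ j, Q (D i) (D j) * x j := by
    intro x i
    rw [map_sum]
    exact sum_congr rfl fun j _ => by rw [map_smul, smul_eq_mul, mul_comm]
  have hκD : ∀ (z : V) i, Q (D i) z = ∑ j, Q (D i) (D j) * κ z j := by
    intro z i
    rw [hQ, hκ]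
    exact sum_congr rfl fun j _ => by rw [hQ (D j), mul_comm]
  have hκκ : ∀ y z, Q y z = ∑ i, κ y i * ∑ j, Q (D i) (D j) * κ z j := by
    intro y z
    rw [hκ]
    exact sum_congr rfl fun i _ => by rw [← hκD]
  have key := hyperbolic_of_bochner (fun i j => Q (D i) (D j)) (κ w) (fun i => R i w w)
    (fun i j => hQ _ _) hκw hoff (fun i => by rw [hR, hκD]) hRw hconn (fun x => by
      set z := ∑ j, x j • D j with hz
      have h1 : ∑ i, x i * ∑ j, Q (D i) (D j) * x j = Q z z := by
        have h2 : Q z = ∑ i, x i • Q (D i) := by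
          rw [hz, map_sum]
          exact sum_congr rfl fun i _ => map_smul _ _ _
        rw [h2, LinearMap.sum_apply]
        exact sum_congr rfl fun i _ => by
          rw [LinearMap.smul_apply, smul_eq_mul, ← hD]
      rw [h1, hsum]
      refine sum_le_sum fun i _ => ?_
      rw [← hD, ← hz, ← hR, mul_div_assoc]
      refine mul_le_mul_of_nonneg_left ?_ (hκw i).le
      rw [le_div_iff₀ (hRw i)]
      exact hRR i z) (κ u)
  rwa [← hκκ, ← hκκ, ← hκκ] at key

end Hyperbolic

section Connected

variable {E : Type*} [Fintype E] [DecidableEq E] {C : Finset (Finset E)} {T T' : Finset E}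

lemma comp_connected (hC : IsProperChain C) (hN : C.card + 3 < Fintype.card E)
    (φ : Finset E → ℝ) (hφ : ∀ S ∈ comp C, ∀ T ∈ comp C, S ⊆ T → φ S = φ T)
    (hT : T ∈ comp C) (hT' : T' ∈ comp C) : φ T = φ T' := by
  by_cases hc1 : T ⊆ T'
  · exact hφ T hT T' hT' hc1
  by_cases hc2 : T' ⊆ T
  · exact (hφ T' hT' T hT hc2).symm
  have h1 := (mem_comp_iff hC).1 hT
  have h2 := (mem_comp_iff hC).1 hT'
  have hdich : ∀ Q ∈ C, Q ⊆ T ∩ T' ∨ T ∪ T' ⊆ Q := by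
    intro Q hQ
    rcases h1.2.2.2 Q hQ with a1 | a1 <;> rcases h2.2.2.2 Q hQ with a2 | a2
    · exact Or.inl (subset_inter a1 a2)
    · exact absurd (a2.trans a1) hc2
    · exact absurd (a1.trans a2) hc1
    · exact Or.inr (union_subset a1 a2)
  have hU : T ∪ T' ≠ ∅ := fun h => h1.2.1 (union_eq_empty.1 h).1
  have hI : T ∩ T' ≠ univ := fun h => h1.2.2.1 (univ_subset_iff.1
    (h ▸ inter_subset_left : univ ⊆ T))
  by_cases hIm : T ∩ T' ∈ comp C
  · rw [← hφ _ hIm _ hT inter_subset_left, ← hφ _ hIm _ hT' inter_subset_right]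
  by_cases hUm : T ∪ T' ∈ comp C
  · rw [hφ _ hT _ hUm subset_union_left, hφ _ hT' _ hUm subset_union_right]
  have hI' : T ∩ T' ∈ C ∨ T ∩ T' = ∅ := by
    by_contra! hcon
    refine hIm ((mem_comp_iff hC).2 ⟨hcon.1, hcon.2.ne_empty, hI, fun S hS => ?_⟩)
    rcases hdich S hS with h | h
    · exact Or.inl h
    · exact Or.inr ((inter_subset_left.trans subset_union_left).trans h)
  have hU' : T ∪ T' ∈ C ∨ T ∪ T' = univ := by
    by_contra! hcon
    refine hUm ((mem_comp_iff hC).2 ⟨hcon.1, hU, hcon.2, fun S hS => ?_⟩)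
    rcases hdich S hS with h | h
    · exact Or.inl (h.trans (inter_subset_left.trans subset_union_left))
    · exact Or.inr h
  have hbetw : ∀ P, T ∩ T' ⊂ P → P ⊂ T ∪ T' → P ∈ comp C := by
    intro P hP1 hP2
    refine (mem_comp_iff hC).2 ⟨fun hP => ?_, ?_, ?_, fun S hS => ?_⟩
    · rcases hdich P hP with h | h
      · exact hP1.not_subset h
      · exact hP2.not_subset h
    · rintro rfl; exact hP1.not_subset (empty_subset _)
    · rintro rfl; exact hP2.not_subset (subset_univ _)
    · rcases hdich S hS with h | h
      · exact Or.inl (h.trans hP1.subset)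
      · exact Or.inr (hP2.subset.trans h)
  have two : ∀ A B : Finset E, A ∈ comp C → B ∈ comp C → A ∩ B = T ∩ T' → A ∪ B = T ∪ T' →
      2 ≤ (A \ B).card → φ A = φ B := by
    intro A B hA hB hAB hAB' hcard
    obtain ⟨s, hs, s', hs', hss⟩ := one_lt_card.1 (by omega : 1 < (A \ B).card)
    rw [mem_sdiff] at hs hs'
    have m1 : insert s (A ∩ B) ∈ comp C := by
      apply hbetw
      · rw [← hAB]; exact ssubset_insert (by simp [hs.2])
      · rw [← hAB']
        refine ssubset_iff_of_subset (by grind) |>.2 ⟨s', by simp [hs'.1], by grind⟩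
    have m2 : insert s B ∈ comp C := by
      apply hbetw
      · rw [← hAB]
        exact ssubset_iff_of_subset (by grind) |>.2 ⟨s, by simp, by simp [hs.2]⟩
      · rw [← hAB']
        refine ssubset_iff_of_subset (by grind) |>.2 ⟨s', by simp [hs'.1], by grind⟩
    rw [← hφ _ m1 A hA (by grind), hφ _ m1 _ m2 (by grind), hφ B hB _ m2 (by grind)]
  by_cases hb1 : 2 ≤ (T \ T').card
  · exact two T T' hT hT' rfl rfl hb1
  by_cases hb2 : 2 ≤ (T' \ T).card
  · exact (two T' T hT' hT (inter_comm _ _) (union_comm _ _) hb2).symm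
  obtain ⟨P, hP⟩ := comp_nonempty (mem_comp.1 hT).2 (by rw [card_insert_of_mem_comp hT]; omega)
  have hP' := (mem_comp_iff (mem_comp.1 hT).2).1 hP
  have hPC : P ∈ comp C := (mem_comp_iff hC).2 ⟨fun h => hP'.1 (mem_insert_of_mem h), hP'.2.1,
    hP'.2.2.1, fun S hS => hP'.2.2.2 S (mem_insert_of_mem hS)⟩
  have hPT : T ≠ P := fun h => hP'.1 (h ▸ mem_insert_self _ _)
  have e1 : (T \ T').card = 1 := by
    have : (T \ T').Nonempty := sdiff_nonempty.2 hc1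
    have := this.card_pos
    omega
  have e2 : (T' \ T).card = 1 := by
    have : (T' \ T).Nonempty := sdiff_nonempty.2 hc2
    have := this.card_pos
    omega
  obtain ⟨s, hs⟩ := card_eq_one.1 e1
  obtain ⟨s', hs'⟩ := card_eq_one.1 e2
  have hsT : ∀ z, z ∈ T ∧ z ∉ T' ↔ z = s := fun z => by rw [← mem_sdiff, hs, mem_singleton]
  have hsT' : ∀ z, z ∈ T' ∧ z ∉ T ↔ z = s' := fun z => by rw [← mem_sdiff, hs', mem_singleton]
  rcases hP'.2.2.2 T (mem_insert_self _ _) with hTP | hPT'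
  · have : T' ⊆ P := by
      rcases hU' with h | h
      · rcases hP'.2.2.2 _ (mem_insert_of_mem h) with h | h
        · exact subset_union_right.trans h
        · exfalso
          by_cases hs'P : s' ∈ P
          · have : P = T ∪ T' := subset_antisymm h (by
              intro z hz
              by_cases hzT : z ∈ T
              · exact hTP hzT
              · rw [(hsT' z).1 ⟨by grind, hzT⟩]; exact hs'P)
            exact hUm (this ▸ hPC)
          · exact hPT (subset_antisymm hTP (by
              intro z hz
              by_contra hzT
              exact hs'P ((hsT' z).1 ⟨by grind, hzT⟩ ▸ hz)))
      · by_contra hcon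
        obtain ⟨z, hz, hzP⟩ := not_subset.1 hcon
        obtain ⟨y, hy, hyT⟩ := not_subset.1 (fun h => hPT (subset_antisymm hTP h) : ¬ P ⊆ T)
        have h3 := (hsT' z).1 ⟨hz, fun h => hzP (hTP h)⟩
        have h4 : y ∈ T ∪ T' := h ▸ mem_univ y
        have h5 := (hsT' y).1 ⟨by grind, hyT⟩
        exact hzP (h3 ▸ h5 ▸ hy)
    rw [hφ _ hT _ hPC hTP, hφ _ hT' _ hPC this]
  · have : P ⊆ T' := by
      rcases hI' with h | h
      · rcases hP'.2.2.2 _ (mem_insert_of_mem h) with h | h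
        · exfalso
          by_cases hsP : s ∈ P
          · exact hPT (subset_antisymm (by
              intro z hz
              by_cases hzT : z ∈ T'
              · exact h (mem_inter.2 ⟨hz, hzT⟩)
              · rw [(hsT z).1 ⟨hz, hzT⟩]; exact hsP) hPT')
          · have : P = T ∩ T' := subset_antisymm (by
              intro z hz
              by_contra hzT
              exact hsP ((hsT z).1 ⟨hPT' hz, fun h' => hzT (mem_inter.2 ⟨hPT' hz, h'⟩)⟩ ▸ hz)) h
            exact hIm (this ▸ hPC)
        · exact h.trans inter_subset_right
      · intro z hz
        by_contra hzT
        have h3 := (hsT z).1 ⟨hPT' hz, hzT⟩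
        refine hPT (subset_antisymm (fun y hy => ?_) hPT')
        have : y ∉ T' := fun hy' => by
          have : y ∈ T ∩ T' := mem_inter.2 ⟨hy, hy'⟩
          simp [h] at this
        rw [(hsT y).1 ⟨hy, this⟩, ← h3]; exact hz
    rw [← hφ _ hPC _ hT hPT', ← hφ _ hPC _ hT' this]

end Connected

section Base

variable {E X : Type*} [Fintype E] [DecidableEq E] [AddCommGroup X] [Module ℝ X]
  {t : E → ℝ} {v : E → X} {W : Submodule ℝ X} {C D ω : Finset (Finset E)} {S T P Q : Finset E}
  {a b c p q e f : E} {r : ℕ} {u w : (Finset E → ℝ) × ℝ}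
  {ws : List ((Finset E → ℝ) × ℝ)} {x y : Finset E → ℝ}

/-- In rank one the linear form of `u` is that of `rankOneReduction v W e u`. -/
noncomputable def rankOneReduction (v : E → X) (W : Submodule ℝ X) (e : E) :
    ((Finset E → ℝ) × ℝ) →ₗ[ℝ] (Finset E → ℝ) :=
  LinearMap.fst ℝ _ _ + LinearMap.toSpanSingleton ℝ _ (cle v W e) ∘ₗ LinearMap.snd ℝ _ _

lemma rankOneReduction_apply : rankOneReduction v W e u = u.1 + u.2 • cle v W e := by
  simp [rankOneReduction]

lemma ell_eq_of_rank_one (h : HasRank v W 1) (he : v e ∉ W) (hω : ω ∈ maxChains E)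
    (hf : f ∈ bas v W ω) : ell t u ω f = lin t ω (rankOneReduction v W e u) := by
  obtain ⟨j, hj, -, hlin⟩ := bas_contract (t := t) hω he
  obtain ⟨i, hi⟩ := card_eq_one.1 (h ω hω)
  rw [hi, mem_singleton] at hf hj
  rw [rankOneReduction_apply, map_add, map_smul, hlin, ell, smul_eq_mul, hf, hj]

lemma modular_insert {k : ℝ} {l : E → ℝ} (h : a ∉ S) :
    modular k l (insert a S) = modular k l S + l a := by
  rw [modular, modular, sum_insert h]; ring

lemma mix_singleton (ht : Function.Injective t) [Nonempty E] (hD : IsProperChain D)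
    (h : HasRank v W 1) (hcard : D.card + 2 = Fintype.card E) (hab : a ≠ b) (ha : a ∉ S)
    (hb : b ∉ S) (hS : S ∈ D ∨ S = ∅) (hSab : insert b (insert a S) ∈ D ∨
      insert b (insert a S) = univ) (hSa : insert a S ∉ D) (hSb : insert b S ∉ D) :
    mix t v W D [(y, 0)] = y (insert a S) + y (insert b S) - y S - y (insert b (insert a S)) := by
  have hdich : ∀ Q ∈ D, Q ⊆ S ∨ insert b (insert a S) ⊆ Q := by
    intro Q hQ
    have h1 : Q ⊆ S ∨ S ⊆ Q := by
      rcases hS with hS | hS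
      · exact hD.total _ hQ _ hS
      · exact Or.inr (hS ▸ empty_subset _)
    have h2 : Q ⊆ insert b (insert a S) ∨ insert b (insert a S) ⊆ Q := by
      rcases hSab with hS | hS
      · exact hD.total _ hQ _ hS
      · exact Or.inl (hS ▸ subset_univ _)
    rcases h1 with h1 | h1
    · exact Or.inl h1
    rcases h2 with h2 | h2
    · have n1 : Q ≠ insert a S := fun h => hSa (h ▸ hQ)
      have n2 : Q ≠ insert b S := fun h => hSb (h ▸ hQ)
      by_cases haQ : a ∈ Q <;> by_cases hbQ : b ∈ Q
      · right; grind
      · exact absurd (by grind) n1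
      · exact absurd (by grind) n2
      · left; grind
    · exact Or.inr h2
  have hun : Unsep D a b := by
    intro Q hQ
    rcases hdich Q hQ with h | h
    · exact ⟨fun h' => absurd (h h') ha, fun h' => absurd (h h') hb⟩
    · exact ⟨fun _ => h (by simp), fun _ => h (by simp)⟩
  have hlo : ∀ z ∈ insert b (insert a S), z ∉ S → lo D z = S := by
    intro z hz hzS
    apply subset_antisymm
    · intro g hg
      obtain ⟨Q, hQ, hzQ, hgQ⟩ := mem_lo.1 hg
      rcases hdich Q hQ with h | h
      · exact h hgQ
      · exact absurd (h hz) hzQ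
    · rcases hS with hS | hS
      · exact subset_lo hS hzS
      · exact hS ▸ empty_subset _
  have hcomp := comp_eq_pair hD hcard hab hun
  rw [hi, hi, hlo a (by simp) ha, hlo b (by simp) hb] at hcomp
  have hne : insert a S ≠ insert b S := fun h => by
    have : a ∈ insert b S := h ▸ mem_insert_self _ _
    grind
  obtain ⟨e, he, heD⟩ := exists_generic hD h
  obtain ⟨k, l, hx⟩ := exists_interpolates hD y
  have hone : ∀ T ∈ comp D, mix t v W (insert T D) [] = 1 := by
    intro T hT
    have hm := insert_mem_maxChains hcard hT
    simp [mix, deg, chainSum_of_mem_maxChains hm, h.loc_one hm]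
  rw [mix_cons_eq (u := (y, 0)) ht hD h (by simp; omega) he heD hx, zero_mul, zero_add,
    hcomp, sum_pair hne, hone _ (by simp [hcomp]), hone _ (by simp [hcomp])]
  have e1 : y S = modular k l S := by
    rcases hS with hS | hS
    · exact hx.1 _ hS
    · rw [hS]; exact hx.2.1
  have e2 : y (insert b (insert a S)) = modular k l (insert b (insert a S)) := by
    rcases hSab with hS | hS
    · exact hx.1 _ hS
    · rw [hS]; exact hx.2.2
  rw [e1, e2, coef, coef, modular_insert (a := b) (S := insert a S) (by grind),
    modular_insert ha, modular_insert hb]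
  simp only [zero_mul, add_zero, mul_one]
  ring

lemma mix_modular (ht : Function.Injective t) [Nonempty E] (hC : IsProperChain C)
    (h : HasRank v W r) (hd : C.card + ws.length + 2 < Fintype.card E + r) (k : ℝ) (l : E → ℝ) :
    mix t v W C ((modular k l, 0) :: ws) = 0 := by
  have : mix t v W C ((modular k l, 0) :: ws) = mix t v W C ws * ∑ e, l e * t e := by
    rw [mix_cons, mix, ← deg_mul_const]
    exact deg_congr fun _ _ _ _ _ => by simp [ell, lin_modular]
  rw [this, mix_eq_zero ht hC h hd, zero_mul]

lemma exists_mix_self_eq (ht : Function.Injective t) [Nonempty E] (hω : ω ∈ maxChains E)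
    (hCω : C ⊆ ω) (h : HasRank v W 1) (hcard : C.card + 3 = Fintype.card E) (he : v e ∉ W)
    (heC : ∀ S ∈ C, v e ∈ clo v W S → e ∈ S) (u : (Finset E → ℝ) × ℝ) :
    ∃ (y : Finset E → ℝ) (k : ℝ) (l : E → ℝ), (∀ T ∈ ω, y T = 0) ∧ y ∅ = 0 ∧ y univ = 0 ∧
      (∀ T, rankOneReduction v W e u T = y T + modular k l T) ∧
      mix t v W C [u, u] = ∑ T ∈ comp C, y T * mix t v W (insert T C) [(y, 0)] := by
  have hC := (mem_maxChains.1 hω).1.mono hCω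
  obtain ⟨k, l, hx⟩ := exists_interpolates (mem_maxChains.1 hω).1 (rankOneReduction v W e u)
  set x := rankOneReduction v W e u with hxdef
  set y := x - modular k l with hy
  have hsplit : ((x, 0) : (Finset E → ℝ) × ℝ) = (y, 0) + (modular k l, 0) := by
    simp [hy]
  have hy0 : ∀ T ∈ ω, y T = 0 := fun T hT => by simp [hy, hx.1 T hT]
  have hy1 : y ∅ = 0 := by simp [hy, hx.2.1]
  have hy2 : y univ = 0 := by simp [hy, hx.2.2]
  refine ⟨y, k, l, hy0, hy1, hy2, fun T => by simp [hy], ?_⟩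
  have h1 : mix t v W C [u, u] = mix t v W C [(x, 0), (x, 0)] :=
    deg_congr fun ω hω _ f hf => by
      simp only [List.map_cons, List.map_nil, ell_eq_of_rank_one h he hω hf]
      simp [rankOneReduction_apply (u := (x, 0)), ← hxdef]
  have hmod : ∀ z : (Finset E → ℝ) × ℝ, mix t v W C [(modular k l, 0), z] = 0 := fun z =>
    mix_modular ht hC h (by simp; omega) k l
  have h2 : mix t v W C [(x, 0), (x, 0)] = mix t v W C [(y, 0), (y, 0)] := by
    rw [hsplit, mix_cons_add, hmod, add_zero, mix_swap, mix_cons_add, hmod, add_zero]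
  rw [h1, h2, mix_cons_eq (u := (y, 0)) (c := 0) (l := 0) ht hC h (by simp; omega) he heC
    ⟨fun T hT => by simp [hy0 T (hCω hT), modular], by simp [hy1, modular],
      by simp [hy2, modular]⟩, zero_mul, zero_add]
  simp [coef, modular]

lemma mix_insert_singleton (ht : Function.Injective t) [Nonempty E] (h : HasRank v W 1)
    (hcard : C.card + 3 = Fintype.card E) {A B M : Finset E} (hT : T ∈ comp C) (hA : A ∈ comp C)
    (hB : B ∈ comp C) (hAT : A ≠ T) (hBT : B ≠ T) (hab : a ≠ b) (ha : a ∉ S) (hb : b ∉ S)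
    (hA' : A = insert a S) (hB' : B = insert b S) (hM' : M = insert b (insert a S))
    (hS : S ∈ insert T C ∨ S = ∅) (hM : M ∈ insert T C ∨ M = univ) :
    mix t v W (insert T C) [(y, 0)] = y A + y B - y S - y M := by
  subst hA' hB' hM'
  exact mix_singleton ht (mem_comp.1 hT).2 h (by rw [card_insert_of_mem_comp hT]; omega) hab ha hb
    hS hM (by simp [hAT, (mem_comp.1 hA).1]) (by simp [hBT, (mem_comp.1 hB).1])

lemma hexagon_nonpos (ht : Function.Injective t) [Nonempty E] (h : HasRank v W 1)
    (hcard : C.card + 3 = Fintype.card E) (hab : a ≠ b) (hac : a ≠ c) (hbc : b ≠ c) (ha : a ∉ S)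
    (hb : b ∉ S) (hc : c ∉ S) (hS : S ∈ C ∨ S = ∅)
    (hM : insert c (insert b (insert a S)) ∈ C ∨ insert c (insert b (insert a S)) = univ)
    (hcomp : comp C = {insert a S, insert b S, insert c S, insert b (insert a S),
      insert c (insert a S), insert c (insert b S)}) (y0 : y S = 0)
    (y1 : y (insert a S) = 0) (y2 : y (insert b (insert a S)) = 0)
    (y3 : y (insert c (insert b (insert a S))) = 0) (y4 : y (insert c S) = 0) :
    ∑ T ∈ comp C, y T * mix t v W (insert T C) [(y, 0)] ≤ 0 := by
  have m1 : insert a S ∈ comp C := by simp [hcomp]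
  have m2 : insert b S ∈ comp C := by simp [hcomp]
  have m3 : insert c S ∈ comp C := by simp [hcomp]
  have m4 : insert b (insert a S) ∈ comp C := by simp [hcomp]
  have m5 : insert c (insert a S) ∈ comp C := by simp [hcomp]
  have m6 : insert c (insert b S) ∈ comp C := by simp [hcomp]
  have hS' : ∀ T, S ∈ insert T C ∨ S = ∅ := fun T => by
      rw [mem_insert, or_assoc]; exact Or.inr ‹_›
  have hM' : ∀ T, insert c (insert b (insert a S)) ∈ insert T C ∨
    insert c (insert b (insert a S)) = univ := fun T => by
      rw [mem_insert, or_assoc]; exact Or.inr ‹_›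
  rw [sum_subset (s₂ := {insert b S, insert c (insert a S), insert c (insert b S)}
    ∪ {insert a S, insert c S, insert b (insert a S)}) (by rw [hcomp]; grind)
      (fun T hT hT' => absurd (by rw [hcomp]; grind) hT'), sum_union_eq_left (by
        intro T hT _
        rw [mem_insert, mem_insert, mem_singleton] at hT
        rcases hT with rfl | rfl | rfl <;> simp [y1, y2, y4]),
    sum_insert, sum_pair,
    mix_insert_singleton (a := a) (b := c) (S := insert b S) ht h hcard m2 m4 m6
      (M := insert c (insert b (insert a S))),
    mix_insert_singleton (a := a) (b := c) (S := S) ht h hcard m5 m1 m3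
      (M := insert c (insert a S)),
    mix_insert_singleton (a := b) (b := c) (S := S) ht h hcard m6 m2 m3
      (M := insert c (insert b S))]
  · rw [y0, y1, y2, y3, y4]
    nlinarith [sq_nonneg (y (insert b S) - y (insert c (insert b S))),
      sq_nonneg (y (insert c (insert a S)))]
  all_goals first
    | assumption
    | exact hS' _
    | exact hM' _
    | rfl
    | (clear hS' hM' m1 m2 m3 m4 m5 m6 hcomp y0 y1 y2 y3 y4 hS hM; grind)
    | (intro hh
       rw [Finset.ext_iff] at hh
       have ha' := hh a
       have hb' := hh b
       have hc' := hh c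
       simp_all)

lemma mem_six_of_between (h1 : S ⊆ T) (h2 : T ⊆ insert c (insert b (insert a S))) (h3 : T ≠ S)
    (h4 : T ≠ insert c (insert b (insert a S))) :
    T ∈ ({insert a S, insert b S, insert c S, insert b (insert a S), insert c (insert a S),
      insert c (insert b S)} : Finset (Finset E)) := by
  simp only [mem_insert, mem_singleton]
  by_cases k1 : a ∈ T <;> by_cases k2 : b ∈ T <;> by_cases k3 : c ∈ T
  · exact absurd (by grind) h4
  · right; right; right; left; grind
  · right; right; right; right; left; grind
  · left; grind
  · right; right; right; right; right; grind
  · right; left; grind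
  · right; right; left; grind
  · exact absurd (by grind) h3

lemma ssubset_of_mem_six (ha : a ∉ S) (hb : b ∉ S) (hc : c ∉ S) (hab : a ≠ b) (hac : a ≠ c)
    (hbc : b ≠ c) (hT : T ∈ ({insert a S, insert b S, insert c S, insert b (insert a S),
      insert c (insert a S), insert c (insert b S)} : Finset (Finset E))) :
    S ⊂ T ∧ T ⊂ insert c (insert b (insert a S)) := by
  simp only [mem_insert, mem_singleton] at hT
  have key : ∀ z z', z ∈ T → z ∉ S → z' ∈ insert c (insert b (insert a S)) → z' ∉ T → S ⊆ T →
      T ⊆ insert c (insert b (insert a S)) → S ⊂ T ∧ T ⊂ insert c (insert b (insert a S)) :=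
    fun z z' h1 h2 h3 h4 h5 h6 => ⟨(ssubset_iff_of_subset h5).2 ⟨z, h1, h2⟩,
      (ssubset_iff_of_subset h6).2 ⟨z', h3, h4⟩⟩
  rcases hT with rfl | rfl | rfl | rfl | rfl | rfl
  · exact key a b (by simp) ha (by simp) (by simp [*, hab.symm]) (by grind) (by grind)
  · exact key b a (by simp) hb (by simp) (by simp [*]) (by grind) (by grind)
  · exact key c a (by simp) hc (by simp) (by simp [*]) (by grind) (by grind)
  · exact key a c (by simp) ha (by simp) (by simp [*, hac.symm, hbc.symm]) (by grind) (by grind)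
  · exact key a b (by simp) ha (by simp) (by simp [*, hab.symm]) (by grind) (by grind)
  · exact key b a (by simp) hb (by simp) (by simp [*]) (by grind) (by grind)

lemma eq_insert_of_between (h1 : S ⊆ T) (h2 : T ⊆ insert b (insert a S)) (h3 : T ≠ S)
    (h4 : T ≠ insert b (insert a S)) : T = insert a S ∨ T = insert b S := by
  by_cases k1 : a ∈ T <;> by_cases k2 : b ∈ T
  · exact absurd (by grind) h4
  · left; grind
  · right; grind
  · exact absurd (by grind) h3

lemma insert_ssubset_pair (ha : a ∉ S) (hb : b ∉ S) (hab : a ≠ b) :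
    (S ⊂ insert a S ∧ insert a S ⊂ insert b (insert a S)) ∧
      (S ⊂ insert b S ∧ insert b S ⊂ insert b (insert a S)) := by
  refine ⟨⟨ssubset_insert ha, ssubset_insert (by simp [hb, hab.symm])⟩, ssubset_insert hb, ?_⟩
  rw [Finset.insert_comm]
  exact ssubset_insert (by simp [ha, hab])

lemma square_nonpos (ht : Function.Injective t) [Nonempty E] (h : HasRank v W 1)
    (hcard : C.card + 3 = Fintype.card E) {S' : Finset E} (hab : a ≠ b) (ha : a ∉ S)
    (hb : b ∉ S) (hS : S ∈ C ∨ S = ∅)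
    (hM : insert b (insert a S) ∈ C ∨ insert b (insert a S) = univ)
    (hSS : insert b (insert a S) ⊆ S')
    (hcomp : comp C = {insert a S, insert b S, insert p S', insert q S'}) (y0 : y S = 0)
    (y1 : y (insert a S) = 0) (y2 : y (insert b (insert a S)) = 0) 
    (y4 : y (insert p S') = 0) (y6 : y (insert b S) = 0) :
    ∑ T ∈ comp C, y T * mix t v W (insert T C) [(y, 0)] ≤ 0 := by
  have m1 : insert a S ∈ comp C := by simp [hcomp]
  have m2 : insert b S ∈ comp C := by simp [hcomp]
  have m3 : insert p S' ∈ comp C := by simp [hcomp]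
  have m4 : insert q S' ∈ comp C := by simp [hcomp]
  have hS1 : ∀ T, S ∈ insert T C ∨ S = ∅ := fun T => by
      rw [mem_insert, or_assoc]; exact Or.inr ‹_›
  have hM1 : ∀ T, insert b (insert a S) ∈ insert T C ∨
    insert b (insert a S) = univ := fun T => by
      rw [mem_insert, or_assoc]; exact Or.inr ‹_›
  rw [sum_eq_single (insert q S'),
    mix_insert_singleton (a := a) (b := b) (S := S) ht h hcard m4 m1 m2
      (M := insert b (insert a S))]
  · rw [y0, y1, y2, y6]
    simp
  all_goals first
    | assumption
    | exact hS1 _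
    | exact hM1 _
    | rfl
    | skip
  · intro hh
    have h1 : b ∈ insert a S := hh ▸ mem_insert_of_mem (hSS (by simp))
    simp [hab.symm, hb] at h1
  · intro hh
    have h1 : a ∈ insert b S := hh ▸ mem_insert_of_mem (hSS (by simp))
    simp [hab, ha] at h1
  · intro T hT hT'
    rw [hcomp] at hT
    simp only [mem_insert, mem_singleton] at hT
    rcases hT with rfl | rfl | rfl | rfl
    · rw [y1, zero_mul]
    · rw [y6, zero_mul]
    · rw [y4, zero_mul]
    · exact absurd rfl hT'
  · exact fun h => absurd m4 h

lemma exists_functional (ht : Function.Injective t) [Nonempty E] (hC : IsProperChain C)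
    (h : HasRank v W 1) (hcard : C.card + 3 = Fintype.card E) :
    ∃ α : ((Finset E → ℝ) × ℝ) →ₗ[ℝ] ℝ, ∀ u, α u = 0 → mix t v W C [u, u] ≤ 0 := by
  obtain ⟨ω, hω, hCω⟩ := hC.exists_maxChain
  have hch := (mem_maxChains.1 hω)
  obtain ⟨e, he, heC⟩ := exists_generic hC h
  have hdiff : (ω \ C).card = 2 := by rw [card_sdiff_of_subset hCω]; omega
  obtain ⟨P, P', hPP, hω'⟩ := card_eq_two.1 hdiff
  have hmem : ∀ Q, (Q ∈ ω ∧ Q ∉ C) ↔ (Q = P ∨ Q = P') := fun Q => by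
    rw [← mem_sdiff, hω', mem_insert, mem_singleton]
  wlog hle : P ⊆ P' generalizing P P'
  · refine this P' P hPP.symm (by rw [hω', pair_comm]) (fun Q => by rw [hmem, or_comm]) ?_
    exact (hch.1.total P ((hmem P).2 (Or.inl rfl)).1 P' ((hmem P').2 (Or.inr rfl)).1).resolve_left
      hle
  have hP := (hmem P).2 (Or.inl rfl)
  have hP' := (hmem P').2 (Or.inr rfl)
  obtain ⟨a, ha⟩ := exists_hi_eq hω (Or.inl hP.1)
  obtain ⟨b, hb⟩ := exists_lo_eq hω (Or.inl hP.1)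
  obtain ⟨p, hp⟩ := exists_hi_eq hω (Or.inl hP'.1)
  obtain ⟨q, hq⟩ := exists_lo_eq hω (Or.inl hP'.1)
  have hlo : ∀ z, lo ω z ≠ P → lo ω z ≠ P' → lo ω z ∈ C ∨ lo ω z = ∅ := by
    intro z h1 h2
    rcases hch.1.lo_mem z with h | h
    · exact Or.inr h
    · left
      by_contra hcon
      rcases (hmem _).1 ⟨h, hcon⟩ with h | h
      · exact h1 h
      · exact h2 h
  have hhi : ∀ z, hi ω z ≠ P → hi ω z ≠ P' → hi ω z ∈ C ∨ hi ω z = univ := by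
    intro z h1 h2
    rcases hi_mem hω z with h | h
    · left
      by_contra hcon
      rcases (hmem _).1 ⟨h, hcon⟩ with h | h
      · exact h1 h
      · exact h2 h
    · exact Or.inr h
  have hcmp : ∀ T ∈ comp C, (P ⊆ T ∨ T ⊆ P) → (P' ⊆ T ∨ T ⊆ P') → T = P ∨ T = P' := by
    intro T hT h1 h2
    have hT' := (mem_comp_iff hC).1 hT
    rcases mem_of_comparable hω (T := T) (fun Q hQ => by
      by_cases hQC : Q ∈ C
      · exact hT'.2.2.2 Q hQC
      · rcases (hmem Q).1 ⟨hQ, hQC⟩ with rfl | rfl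
        · exact h1
        · exact h2) with h | h | h
    · exact (hmem T).1 ⟨h, hT'.1⟩
    · exact absurd h hT'.2.1
    · exact absurd h hT'.2.2.1
  have hself : ∀ z, z ∈ hi ω z := fun z => mem_insert_self _ _
  have hbP : b ∉ P := hb ▸ notMem_lo
  have hqP : q ∉ P' := hq ▸ notMem_lo
  have hloa : lo ω a ⊂ P := by rw [← ha]; exact ssubset_insert notMem_lo
  have hlop : lo ω p ⊂ P' := by rw [← hp]; exact ssubset_insert notMem_lo
  have hhib : P ⊂ hi ω b := by rw [← hb]; exact ssubset_insert notMem_lo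
  have hhiq : P' ⊂ hi ω q := by rw [← hq]; exact ssubset_insert notMem_lo
  have hPP' : P ⊂ P' := hle.ssubset_of_ne hPP
  have hSC := hlo a hloa.ne (hloa.trans hPP').ne
  have hMC := hhi q (hPP'.trans hhiq).ne' hhiq.ne'
  have hTlo : ∀ T ∈ comp C, ∀ S, S ∈ C ∨ S = ∅ → S ⊆ T ∨ T ⊆ S := by
    rintro T hT S (hS | rfl)
    · exact ((mem_comp_iff hC).1 hT).2.2.2 S hS
    · exact Or.inl (empty_subset _)
  have hThi : ∀ T ∈ comp C, ∀ S, S ∈ C ∨ S = univ → S ⊆ T ∨ T ⊆ S := by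
    rintro T hT S (hS | rfl)
    · exact ((mem_comp_iff hC).1 hT).2.2.2 S hS
    · exact Or.inr (subset_univ _)
  have hTne : ∀ T ∈ comp C, ∀ S, S ∈ C ∨ S = ∅ ∨ S = univ → T ≠ S := by
    rintro T hT S hS rfl
    have := (mem_comp_iff hC).1 hT
    rcases hS with h | h | h
    · exact this.1 h
    · exact this.2.1 h
    · exact this.2.2.1 h
  have hyz : ∀ y : Finset E → ℝ, (∀ T ∈ ω, y T = 0) → y ∅ = 0 → y univ = 0 →
      ∀ z, y (lo ω z) = 0 ∧ y (hi ω z) = 0 := by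
    intro y h1 h2 h3 z
    constructor
    · rcases hch.1.lo_mem z with h | h
      · rw [h, h2]
      · exact h1 _ h
    · rcases hi_mem hω z with h | h
      · exact h1 _ h
      · rw [h, h3]
  have hgap : ∀ Q ∈ C, ((Q ⊆ lo ω a ∨ hi ω b ⊆ Q) ∨ Q = P) ∧
      ((Q ⊆ lo ω p ∨ hi ω q ⊆ Q) ∨ Q = P') := by
    intro Q hQ
    have hQω := hCω hQ
    constructor
    · by_cases h1 : a ∈ Q
      · by_cases h2 : b ∈ Q
        · exact Or.inl (Or.inr (hch.1.hi_subset hQω h2))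
        · exact Or.inr (subset_antisymm (hb ▸ subset_lo hQω h2)
            (ha ▸ hch.1.hi_subset hQω h1))
      · exact Or.inl (Or.inl (subset_lo hQω h1))
    · by_cases h1 : p ∈ Q
      · by_cases h2 : q ∈ Q
        · exact Or.inl (Or.inr (hch.1.hi_subset hQω h2))
        · exact Or.inr (subset_antisymm (hq ▸ subset_lo hQω h2)
            (hp ▸ hch.1.hi_subset hQω h1))
      · exact Or.inl (Or.inl (subset_lo hQω h1))
  have hgap' : ∀ Q ∈ C, (Q ⊆ lo ω a ∨ hi ω b ⊆ Q) ∧ (Q ⊆ lo ω p ∨ hi ω q ⊆ Q) := by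
    intro Q hQ
    have h1 : Q ≠ P := fun h => hP.2 (h ▸ hQ)
    have h2 : Q ≠ P' := fun h => hP'.2 (h ▸ hQ)
    obtain ⟨h3, h4⟩ := hgap Q hQ
    rw [or_iff_left h1] at h3
    rw [or_iff_left h2] at h4
    exact ⟨h3, h4⟩
  let L := fun T : Finset E => LinearMap.proj (R := ℝ) (φ := fun _ : Finset E => ℝ) T ∘ₗ
    rankOneReduction v W e
  by_cases hbp : b = p
  · subst hbp
    have e1 : P = insert a (lo ω a) := ha.symm
    have e2 : P' = insert b (insert a (lo ω a)) := by rw [← hp, hi, hb, e1]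
    have e3 : hi ω q = insert q (insert b (insert a (lo ω a))) := by rw [hi, hq, e2]
    have haS : a ∉ lo ω a := notMem_lo
    have hbS : b ∉ lo ω a := fun h => hbP (hloa.subset h)
    have hqS : q ∉ lo ω a := fun h => hqP ((hloa.trans hPP').subset h)
    have hab : a ≠ b := by rintro rfl; exact hbP (e1 ▸ mem_insert_self _ _)
    have haq : a ≠ q := by rintro rfl; exact hqP (e2 ▸ by simp)
    have hbq : b ≠ q := by rintro rfl; exact hqP (e2 ▸ by simp)
    rw [e3] at hMC hhiq
    have hdich : ∀ Q ∈ C, Q ⊆ lo ω a ∨ hi ω q ⊆ Q := by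
      intro Q hQ
      rcases (hgap' Q hQ).1 with h1 | h1
      · exact Or.inl h1
      rcases (hgap' Q hQ).2 with h2 | h2
      · exact absurd (h2 (h1 (hself b))) notMem_lo
      · exact Or.inr h2
    have hcomp : comp C = {insert a (lo ω a), insert b (lo ω a), insert q (lo ω a),
        insert b (insert a (lo ω a)), insert q (insert a (lo ω a)),
        insert q (insert b (lo ω a))} := by
      ext T
      constructor
      · intro hT
        have n1 := hTne T hT _ (hSC.imp_right Or.inl)
        have n2 := hTne T hT _ (hMC.imp_right Or.inr)
        have h3 : lo ω a ⊆ T := by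
          rcases hTlo T hT _ hSC with h | h
          · exact h
          · rcases hcmp T hT (Or.inr (h.trans hloa.subset))
              (Or.inr (h.trans (hloa.trans hPP').subset)) with rfl | rfl
            · exact absurd h hloa.not_subset
            · exact absurd h (hloa.trans hPP').not_subset
        have h4 : T ⊆ insert q (insert b (insert a (lo ω a))) := by
          rcases hThi T hT _ hMC with h | h
          · rcases hcmp T hT (Or.inl ((hPP'.trans hhiq).subset.trans h))
              (Or.inl (hhiq.subset.trans h)) with rfl | rfl
            · exact absurd h (hPP'.trans hhiq).not_subset
            · exact absurd h hhiq.not_subset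
          · exact h
        exact mem_six_of_between h3 h4 n1 n2
      · intro hT
        obtain ⟨h3, h4⟩ := ssubset_of_mem_six haS hbS hqS hab haq hbq hT
        rw [← e3] at h4
        refine (mem_comp_iff hC).2 ⟨fun h => ?_, ?_, ?_, fun Q hQ => ?_⟩
        · rcases hdich T h with h | h
          · exact h3.not_subset h
          · exact h4.not_subset h
        · rintro rfl; exact h3.not_subset (empty_subset _)
        · rintro rfl; exact h4.not_subset (subset_univ _)
        · rcases hdich Q hQ with h | h
          · exact Or.inl (h.trans h3.subset)
          · exact Or.inr (h4.subset.trans h)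
    refine ⟨L (insert q (lo ω a)) + L P' - L (lo ω a) - L (hi ω q), fun u hu => ?_⟩
    obtain ⟨y, k, l, h1, h2, h3, h4, h5⟩ := exists_mix_self_eq ht hω hCω h hcard he heC u
    have hz := hyz y h1 h2 h3
    rw [h5]
    refine hexagon_nonpos ht h hcard hab haq hbq haS hbS hqS hSC hMC hcomp (hz a).1 (hz a).2
      (e2 ▸ hp ▸ (hz b).2) (e3 ▸ (hz q).2) ?_
    simp only [L, LinearMap.sub_apply, LinearMap.add_apply, LinearMap.comp_apply,
      LinearMap.proj_apply, h4, (hz a).1, e3, e2] at hu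
    rw [← e2, h1 P' hP'.1, e2, modular_insert hqS,
      modular_insert (a := q) (by simp [hqS, haq.symm, hbq.symm])] at hu
    have := (hz q).2
    rw [e3] at this
    linarith
  · have hbp' : hi ω b ≠ P' := fun h => hbp (hi_injective hω (h.trans hp.symm))
    have hpP : lo ω p ≠ P := fun h => hbp (lo_injective hω (hb.trans h.symm))
    have hMC1 := hhi b hhib.ne' hbp'
    have hSC1 := hlo p hpP hlop.ne
    have hsub : hi ω b ⊆ lo ω p := by
      rcases hi_subset_lo_or hω hbp with h | h
      · exact h
      · rw [hp, hb] at h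
        exact absurd h hPP'.not_subset
    have e1 : P = insert a (lo ω a) := ha.symm
    have e2 : hi ω b = insert b (insert a (lo ω a)) := by rw [hi, hb, e1]
    have e3 : P' = insert p (lo ω p) := hp.symm
    have e4 : hi ω q = insert q (insert p (lo ω p)) := by rw [hi, hq, e3]
    have haS : a ∉ lo ω a := notMem_lo
    have hbS : b ∉ lo ω a := fun h => hbP (hloa.subset h)
    have hpS : p ∉ lo ω p := notMem_lo
    have hqS : q ∉ lo ω p := fun h => hqP (hlop.subset h)
    have hab : a ≠ b := by rintro rfl; exact hbP (e1 ▸ mem_insert_self _ _)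
    have hpq : p ≠ q := by rintro rfl; exact hqP (e3 ▸ mem_insert_self _ _)
    have hcomp : comp C = {insert a (lo ω a), insert b (lo ω a), insert p (lo ω p),
        insert q (lo ω p)} := by
      ext T
      constructor
      · intro hT
        have n1 := hTne T hT _ (hSC.imp_right Or.inl)
        have n2 := hTne T hT _ (hMC1.imp_right Or.inr)
        have n3 := hTne T hT _ (hSC1.imp_right Or.inl)
        have n4 := hTne T hT _ (hMC.imp_right Or.inr)
        simp only [mem_insert, mem_singleton]
        by_cases c1 : lo ω a ⊆ T ∧ T ⊆ hi ω b
        · rw [e2] at c1 n2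
          rcases eq_insert_of_between c1.1 c1.2 n1 n2 with h | h <;> simp [h]
        by_cases c2 : lo ω p ⊆ T ∧ T ⊆ hi ω q
        · rw [e4] at c2 n4
          rcases eq_insert_of_between c2.1 c2.2 n3 n4 with h | h <;> simp [h]
        have c1' : P ⊆ T ∨ T ⊆ P := by
          rcases hTlo T hT _ hSC with h | h
          · rcases hThi T hT _ hMC1 with h' | h'
            · exact Or.inl (hhib.subset.trans h')
            · exact absurd ⟨h, h'⟩ c1
          · exact Or.inr (h.trans hloa.subset)
        have c2' : P' ⊆ T ∨ T ⊆ P' := by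
          rcases hTlo T hT _ hSC1 with h | h
          · rcases hThi T hT _ hMC with h' | h'
            · exact Or.inl (hhiq.subset.trans h')
            · exact absurd ⟨h, h'⟩ c2
          · exact Or.inr (h.trans hlop.subset)
        rcases hcmp T hT c1' c2' with h | h
        · exact Or.inl (h.trans e1)
        · exact Or.inr (Or.inr (Or.inl (h.trans e3)))
      · intro hT
        have h3 : (lo ω a ⊂ T ∧ T ⊂ hi ω b) ∨ (lo ω p ⊂ T ∧ T ⊂ hi ω q) := by
          rw [e2, e4]
          simp only [mem_insert, mem_singleton] at hT
          rcases hT with rfl | rfl | rfl | rfl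
          · exact Or.inl (insert_ssubset_pair haS hbS hab).1
          · exact Or.inl (insert_ssubset_pair haS hbS hab).2
          · exact Or.inr (insert_ssubset_pair hpS hqS hpq).1
          · exact Or.inr (insert_ssubset_pair hpS hqS hpq).2
        refine (mem_comp_iff hC).2 ⟨fun h => ?_, ?_, ?_, fun Q hQ => ?_⟩
        · rcases h3 with h3 | h3
          · rcases (hgap' T h).1 with h | h
            · exact h3.1.not_subset h
            · exact h3.2.not_subset h
          · rcases (hgap' T h).2 with h | h
            · exact h3.1.not_subset h
            · exact h3.2.not_subset h
        · rintro rfl; exact h3.elim (fun h => h.1.not_subset (empty_subset _))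
            (fun h => h.1.not_subset (empty_subset _))
        · rintro rfl; exact h3.elim (fun h => h.2.not_subset (subset_univ _))
            (fun h => h.2.not_subset (subset_univ _))
        · rcases h3 with h3 | h3
          · rcases (hgap' Q hQ).1 with h | h
            · exact Or.inl (h.trans h3.1.subset)
            · exact Or.inr (h3.2.subset.trans h)
          · rcases (hgap' Q hQ).2 with h | h
            · exact Or.inl (h.trans h3.1.subset)
            · exact Or.inr (h3.2.subset.trans h)
    refine ⟨L P + L (insert b (lo ω a)) - L (lo ω a) - L (hi ω b), fun u hu => ?_⟩
    obtain ⟨y, k, l, h1, h2, h3, h4, h5⟩ := exists_mix_self_eq ht hω hCω h hcard he heC u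
    have hz := hyz y h1 h2 h3
    rw [h5]
    refine square_nonpos ht h hcard hab haS hbS hSC (e2 ▸ hMC1)
      (e2 ▸ hsub) hcomp (hz a).1 (hz a).2 (e2 ▸ (hz b).2) (hz p).2 ?_
    simp only [L, LinearMap.sub_apply, LinearMap.add_apply, LinearMap.comp_apply,
      LinearMap.proj_apply, h4, (hz a).1, (hz b).2, h1 P hP.1] at hu
    rw [e2, modular_insert hbS, modular_insert (a := b) (by simp [hbS, hab.symm]), ← e1] at hu
    linarith

end Base

section LogConcave

variable {E X : Type*} [Fintype E] [DecidableEq E] [AddCommGroup X] [Module ℝ X]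
  {t : E → ℝ} {v : E → X} {W : Submodule ℝ X} {C D ω : Finset (Finset E)} {S T : Finset E}
  {e : E} {r : ℕ} {u w : (Finset E → ℝ) × ℝ} {ws : List ((Finset E → ℝ) × ℝ)}

variable (t v W C ws) in
/-- The symmetric bilinear form obtained by fixing all but two of the arguments of `mix`. -/
noncomputable def mixForm :
    ((Finset E → ℝ) × ℝ) →ₗ[ℝ] ((Finset E → ℝ) × ℝ) →ₗ[ℝ] ℝ :=
  LinearMap.mk₂ ℝ (fun u z => mix t v W C (u :: z :: ws))
    (fun _ _ _ => mix_cons_add) (fun _ _ _ => mix_cons_smul)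
    (fun u z z' => by rw [mix_swap, mix_cons_add, mix_swap, mix_swap (u := z')])
    (fun c u z => by rw [mix_swap, mix_cons_smul, mix_swap, smul_eq_mul])

lemma mixForm_apply (u z : (Finset E → ℝ) × ℝ) :
    mixForm t v W C ws u z = mix t v W C (u :: z :: ws) := rfl

lemma mix_ind_of_notMem_comp (ht : Function.Injective t) (h1 : T ∉ C) (h2 : T ≠ ∅)
    (h3 : T ≠ univ) (hT : T ∉ comp C) : mix t v W C ((ind T, 0) :: ws) = 0 := by
  have : mix t v W C ((ind T, 0) :: ws) =
      deg t v W C (fun ω f => (ws.map fun w => ell t w ω f).prod * lin t ω (ind T)) := by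
    rw [mix_cons]; simp [ell]
  rw [this, deg_mul_lin ht]
  · refine sum_eq_zero fun S hS => ?_
    have : S ≠ T := by rintro rfl; exact hT hS
    simp [ind, this]
  · intro S hS
    have : S ≠ T := by rintro rfl; exact h1 hS
    simp [ind, this]
  · simp [ind, h2.symm]
  · simp [ind, h3.symm]

lemma mixForm_symm (u z : (Finset E → ℝ) × ℝ) :
    mixForm t v W C ws u z = mixForm t v W C ws z u := mix_swap

lemma comp_eq_empty [Nonempty E] (h : Fintype.card E ≤ C.card + 1) : comp C = ∅ := by
  refine eq_empty_of_forall_notMem fun T hT => ?_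
  have h1 := (mem_comp.1 hT).2.card_lt
  rw [card_insert_of_mem_comp hT] at h1
  omega

lemma mem_comp_insert (hT : T ∈ comp C) (hS : S ∈ comp C) (hne : S ≠ T) (hTS : T ⊆ S ∨ S ⊆ T) :
    S ∈ comp (insert T C) := by
  obtain ⟨hS1, hS2⟩ := mem_comp.1 hS
  obtain ⟨hC, h1, h2, h3⟩ := isProperChain_insert.1 hS2
  refine (mem_comp_iff (mem_comp.1 hT).2).2 ⟨by simp [hne, hS1], h1, h2, fun Q hQ => ?_⟩
  rcases mem_insert.1 hQ with rfl | hQ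
  · exact hTS
  · exact h3 Q hQ

lemma mix_hyperbolic_nil (ht : Function.Injective t) [Nonempty E] (hC : IsProperChain C)
    (h : HasRank v W r) (hr : 1 ≤ r) (hd : C.card + 4 = Fintype.card E + r) (hw : Ample w)
    (u : (Finset E → ℝ) × ℝ) :
    mixForm t v W C [] u u * mixForm t v W C [] w w ≤ mixForm t v W C [] u w ^ 2 := by
  have hpos : 0 < mixForm t v W C [] w w :=
    mix_pos ht hC h hr (by simp; omega) (by simp [hw])
  suffices H : ∃ α : ((Finset E → ℝ) × ℝ) →ₗ[ℝ] ℝ, ∀ u, α u = 0 →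
      mixForm t v W C [] u u ≤ 0 by
    obtain ⟨α, hα⟩ := H
    exact hyperbolic_of_functional _ mixForm_symm α hα hpos u
  obtain rfl | hr := hr.eq_or_lt
  · exact exists_functional ht hC h (by omega)
  refine ⟨LinearMap.snd ℝ _ _, fun z (hz : z.2 = 0) => le_of_eq ?_⟩
  have key : ∀ {C' : Finset (Finset E)}, IsProperChain C' → ∀ zs : List ((Finset E → ℝ) × ℝ),
      C'.card + zs.length + 2 < Fintype.card E + r → ∃ κ : Finset E → ℝ,
      mix t v W C' (z :: zs) = ∑ T ∈ comp C', κ T * mix t v W (insert T C') zs := by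
    intro C' hC' zs hzs
    obtain ⟨s, rfl⟩ := Nat.exists_eq_add_of_lt hr
    obtain ⟨e, he, heC⟩ := exists_generic hC' h
    obtain ⟨c, l, hx⟩ := exists_interpolates hC' z.1
    refine ⟨coef v W e c l z, ?_⟩
    rw [mix_cons_eq ht hC' h hzs he heC hx, hz, zero_mul, zero_add]
  obtain ⟨κ, hκ⟩ := key hC [z] (by simp; omega)
  rw [mixForm_apply, hκ]
  refine sum_eq_zero fun T hT => ?_
  have hcard := card_insert_of_mem_comp hT
  obtain ⟨κ', hκ'⟩ := key (mem_comp.1 hT).2 [] (by simp; omega)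
  rw [hκ', comp_eq_empty (by omega), sum_empty, mul_zero]

theorem mix_hyperbolic (ht : Function.Injective t) [Nonempty E] (hC : IsProperChain C)
    (h : HasRank v W r) (hr : 1 ≤ r) (hd : C.card + ws.length + 4 = Fintype.card E + r)
    (hws : ∀ z ∈ ws, Ample z) (hw : Ample w) (u : (Finset E → ℝ) × ℝ) :
    mixForm t v W C ws u u * mixForm t v W C ws w w ≤ mixForm t v W C ws u w ^ 2 := by
  induction ws generalizing C W r u w with
  | nil => exact mix_hyperbolic_nil ht hC h hr (by simpa using hd) hw u
  | cons z ws ih =>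
    obtain ⟨r, rfl⟩ := Nat.exists_eq_add_of_le' hr
    rw [List.length_cons] at hd
    have hz := hws z (by simp)
    have hws' : ∀ z ∈ ws, Ample z := fun y hy => hws y (by simp [hy])
    have hpos : ∀ y, Ample y → 0 < mixForm t v W C (z :: ws) y y := fun y hy =>
      mix_pos ht hC h hr (by simp; omega) (by simpa [hy, hz] using fun a b hab => hws' _ hab)
    refine hyperbolic_transfer _ mixForm_symm (hpos z hz) ?_ (hpos w hw) u
    obtain ⟨e, he, heC⟩ := exists_generic hC h
    have hinterp : ∀ y : (Finset E → ℝ) × ℝ, ∃ c l, Interpolates C y.1 c l ∧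
        (Ample y → ∀ T, T ∉ C → T ≠ ∅ → T ≠ univ → modular c l T < y.1 T) := by
      intro y
      by_cases hy : Ample y
      · obtain ⟨c, l, h1, h2⟩ := hy.1 C hC
        exact ⟨c, l, h1, fun _ => h2⟩
      · obtain ⟨c, l, h1⟩ := exists_interpolates hC y.1
        exact ⟨c, l, h1, fun h => absurd h hy⟩
    choose c l hx hx' using hinterp
    have expand : ∀ (y : (Finset E → ℝ) × ℝ) (zs : List ((Finset E → ℝ) × ℝ)),
        C.card + zs.length + 2 < Fintype.card E + (r + 1) →
        mix t v W C (y :: zs) = y.2 * mix t v (W ⊔ Submodule.span ℝ {v e}) C zs +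
          ∑ T : {T // T ∈ comp C}, coef v W e (c y) (l y) y T *
            mix t v W (insert (T : Finset E) C) zs := by
      intro y zs hzs
      rw [mix_cons_eq ht hC h hzs he heC (hx y), ← sum_coe_sort]
    have hcoef : ∀ T : {T // T ∈ comp C}, 0 < coef v W e (c z) (l z) z T := fun T =>
      coef_pos hz.2 (hx' z hz) T.2
    have hcard : ∀ T : {T // T ∈ comp C}, (insert (T : Finset E) C).card = C.card + 1 :=
      fun T => card_insert_of_mem_comp T.2
    have hofft : ∀ T T' : {T // T ∈ comp C}, T ≠ T' →
        0 ≤ mixForm t v W C (z :: ws) (ind T, 0) (ind T', 0) := by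
      intro T T' hne
      have hT' := (mem_comp_iff hC).1 T'.2
      rw [mixForm_apply, mix_ind ht T.2]
      by_cases hm : (T' : Finset E) ∈ comp (insert (T : Finset E) C)
      · rw [mix_ind ht hm]
        refine (mix_pos ht (mem_comp.1 hm).2 h hr ?_ hws).le
        rw [card_insert_of_mem_comp hm, hcard, List.length_cons]
        omega
      · rw [mix_ind_of_notMem_comp ht _ hT'.2.1 hT'.2.2.1 hm]
        simpa [hT'.1] using fun h => hne h.symm
    have hoffpos : ∀ T T' : {T // T ∈ comp C}, (T : Finset E) ≠ T' → (T : Finset E) ⊆ T' →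
        0 < mixForm t v W C (z :: ws) (ind T, 0) (ind T', 0) := by
      intro T T' hne hsub
      have hm := mem_comp_insert T.2 T'.2 hne.symm (Or.inl hsub)
      rw [mixForm_apply, mix_ind ht T.2, mix_ind ht hm]
      refine mix_pos ht (mem_comp.1 hm).2 h hr ?_ hws
      rw [card_insert_of_mem_comp hm, hcard, List.length_cons]
      omega
    have hRRT : ∀ (T : {T // T ∈ comp C}) y,
        mixForm t v W (insert (T : Finset E) C) ws y y *
          mixForm t v W (insert (T : Finset E) C) ws z z ≤
          mixForm t v W (insert (T : Finset E) C) ws y z ^ 2 := fun T y =>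
      ih (mem_comp.1 T.2).2 h hr (by rw [hcard]; omega) hws' hz y
    have hRT : ∀ (T : {T // T ∈ comp C}) y, mixForm t v W (insert (T : Finset E) C) ws y z =
        mixForm t v W C (z :: ws) (ind T, 0) y := fun T y => by
      rw [mixForm_apply, mixForm_apply, mix_ind ht T.2]
    have hRwT : ∀ T : {T // T ∈ comp C}, 0 < mixForm t v W (insert (T : Finset E) C) ws z z :=
      fun T => mix_pos ht (mem_comp.1 T.2).2 h hr
        (by rw [hcard, List.length_cons, List.length_cons]; omega)
        (by simpa [hz] using fun a b hab => hws' _ hab)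
    have hrot : ∀ y, mixForm t v W C (z :: ws) y y = mix t v W C (z :: y :: y :: ws) := fun y => by
      rw [mixForm_apply]
      refine mix_perm ?_
      exact (List.Perm.cons y (List.Perm.swap z y ws)).trans (List.Perm.swap z y (y :: ws))
    rcases r with _ | r
    · have h0 : ∀ zs, mix t v (W ⊔ Submodule.span ℝ {v e}) C zs = 0 := fun zs =>
        (h.contract he).deg_eq_zero
      refine hyperbolic_step (ι := {T // T ∈ comp C}) _ mixForm_symm (fun T => (ind T, 0))
        (fun y T => coef v W e (c y) (l y) y T) ?_
        (fun T y y' => mixForm t v W (insert (T : Finset E) C) ws y y') z hcoef hRT hRwT hRRT ?_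
        hofft ?_
      · intro y y'
        rw [mixForm_apply, expand _ _ (by simp; omega), h0, mul_zero, zero_add]
        exact sum_congr rfl fun T _ => by rw [mixForm_apply, mix_ind ht T.2]
      · intro y
        rw [hrot, expand _ _ (by simp; omega), h0, mul_zero, zero_add]
        rfl
      · intro φ hφ
        classical
        obtain ⟨T₀, hT₀⟩ := comp_nonempty hC (by omega)
        refine ⟨φ ⟨T₀, hT₀⟩, fun T => ?_⟩
        have := comp_connected hC (by omega) (fun S => if hS : S ∈ comp C then φ ⟨S, hS⟩ else 0)
          (fun S hS S' hS' hsub => by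
            simp only [hS, hS', dif_pos]
            by_cases heq : S = S'
            · subst heq; rfl
            · exact hφ ⟨S, hS⟩ ⟨S', hS'⟩ (fun h => heq (Subtype.ext_iff.1 h))
                (hoffpos ⟨S, hS⟩ ⟨S', hS'⟩ heq hsub)) T.2 hT₀
        simpa [hT₀] using this
    · have hc := h.contract he
      have hnone : ∀ T : {T // T ∈ comp C},
          0 < mixForm t v W C (z :: ws) (-cle v W e, 1) (ind T, 0) := by
        intro T
        rw [mixForm_apply, mix_contract ht he, mix_ind ht T.2]
        exact mix_pos ht (mem_comp.1 T.2).2 hc (by omega)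
          (by rw [hcard, List.length_cons]; omega) hws
      refine hyperbolic_step (ι := Option {T // T ∈ comp C}) _ mixForm_symm
        (fun i => i.elim (-cle v W e, 1) fun T => (ind T, 0))
        (fun y i => i.elim y.2 fun T => coef v W e (c y) (l y) y T) ?_
        (fun i y y' => i.elim (mixForm t v (W ⊔ Submodule.span ℝ {v e}) C ws y y')
          fun T => mixForm t v W (insert (T : Finset E) C) ws y y') z ?_ ?_ ?_ ?_ ?_ ?_ ?_
      · intro y y'
        rw [mixForm_apply, expand _ _ (by simp; omega), Fintype.sum_option]
        simp only [Option.elim_none, Option.elim_some, mixForm_apply, mix_contract ht he]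
        congr 1
        exact sum_congr rfl fun T _ => by rw [mix_ind ht T.2]
      · rintro (_ | T)
        · exact hz.2
        · exact hcoef T
      · rintro (_ | T) y
        · simp only [Option.elim_none, mixForm_apply, mix_contract ht he]
        · exact hRT T y
      · rintro (_ | T)
        · exact mix_pos ht hC hc (by omega) (by rw [List.length_cons, List.length_cons]; omega)
            (by simpa [hz] using fun a b hab => hws' _ hab)
        · exact hRwT T
      · rintro (_ | T) y
        · exact ih hC hc (by omega) (by omega) hws' hz y
        · exact hRRT T y
      · intro y
        rw [hrot, expand _ _ (by simp; omega), Fintype.sum_option]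
        rfl
      · rintro (_ | T) (_ | T') hne
        · exact absurd rfl hne
        · exact (hnone T').le
        · exact (mixForm_symm (t := t) (v := v) (W := W) (C := C) _ _).le.trans' (hnone T).le
        · exact hofft T T' fun h => hne (by rw [h])
      · intro φ hφ
        refine ⟨φ none, ?_⟩
        rintro (_ | T)
        · rfl
        · exact (hφ none (some T) (by simp) (hnone T)).symm

end LogConcave

section Cone

variable {E X : Type*} [Fintype E] [DecidableEq E] [AddCommGroup X] [Module ℝ X]
  {t : E → ℝ} {v : E → X} {W : Submodule ℝ X} {C D ω : Finset (Finset E)} {S T : Finset E}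
  {e : E} {r : ℕ} {x y : Finset E → ℝ} {ε : ℝ}

lemma modular_add (c c' : ℝ) (l l' : E → ℝ) :
    modular (c + c') (l + l') T = modular c l T + modular c' l' T := by
  simp [modular, sum_add_distrib]; ring

lemma modular_smul (a c : ℝ) (l : E → ℝ) : modular (a * c) (a • l) T = a * modular c l T := by
  simp [modular, mul_add, mul_sum]

lemma Amp.smul (hx : Amp x) (hε : 0 < ε) : Amp (ε • x) := by
  intro C hC
  obtain ⟨c, l, h, h'⟩ := hx C hC
  refine ⟨ε * c, ε • l, ⟨fun T hT => ?_, ?_, ?_⟩, fun T h1 h2 h3 => ?_⟩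
  · simp [modular_smul, h.1 T hT]
  · simp [modular_smul, h.2.1]
  · simp [modular_smul, h.2.2]
  · simpa [modular_smul] using mul_lt_mul_of_pos_left (h' T h1 h2 h3) hε

lemma Nef.add_amp (hy : Nef y) (hx : Amp x) : Amp (y + x) := by
  intro C hC
  obtain ⟨c, l, h, h'⟩ := hy C hC
  obtain ⟨d, m, k, k'⟩ := hx C hC
  refine ⟨c + d, l + m, ⟨fun T hT => ?_, ?_, ?_⟩, fun T h1 h2 h3 => ?_⟩
  · simp [modular_add, h.1 T hT, k.1 T hT]
  · simp [modular_add, h.2.1, k.2.1]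
  · simp [modular_add, h.2.2, k.2.2]
  · simpa [modular_add] using add_lt_add_of_le_of_lt (h' T) (k' T h1 h2 h3)

lemma nef_neg_ind_empty [Nonempty E] : Nef (-ind (∅ : Finset E)) := by
  intro C hC
  obtain ⟨ω, hω, hCω⟩ := hC.exists_maxChain
  obtain ⟨i, hi⟩ := exists_lo_eq hω (Or.inr rfl)
  have hm : ∀ T : Finset E, modular (-1) (Pi.single i 1 : E → ℝ) T = if i ∈ T then 0 else -1 := by
    intro T
    simp only [modular, Pi.single_apply, sum_ite_eq']
    split_ifs <;> norm_num
  refine ⟨-1, Pi.single i 1, ⟨fun T hT => ?_, ?_, ?_⟩, fun T => ?_⟩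
  · have hiT : i ∈ T := by
      by_contra hcon
      have := subset_lo (hCω hT) hcon
      rw [hi, subset_empty] at this
      exact hC.empty_notMem (this ▸ hT)
    have : T ≠ ∅ := ne_empty_of_mem hiT
    simp [hm, hiT, ind, this]
  · simp [hm, ind]
  · simp [hm, ind, univ_nonempty.ne_empty]
  · by_cases hT : T = ∅
    · subst hT; simp [hm, ind]
    · have : ind (∅ : Finset E) T = 0 := by simp [ind, hT]
      rw [hm, Pi.neg_apply, this]
      split_ifs <;> norm_num

variable (E) in
/-- The strictly concave function `|T| (|E| - |T|)`. -/
def concave (T : Finset E) : ℝ := T.card * (Fintype.card E - T.card)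

lemma mem_of_forall_mem_lo (hC : IsProperChain C) (h0 : T ≠ ∅) (h1 : T ≠ univ)
    (h : ∀ e ∈ T, ∀ g, g ∉ T → e ∈ lo C g) : T ∈ C := by
  obtain ⟨g₀, hg₀⟩ : ∃ g, g ∉ T := by simpa [eq_univ_iff_forall] using h1
  obtain ⟨g, hg, hmin⟩ := exists_min_image (univ.filter (· ∉ T)) (fun g => (lo C g).card)
    ⟨g₀, by simp [hg₀]⟩
  rw [mem_filter] at hg
  have hsub : T ⊆ lo C g := fun e he => h e he g hg.2
  have hmem : lo C g ∈ C := (hC.lo_mem g).resolve_left fun h' =>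
    h0 (subset_empty.1 (h' ▸ hsub))
  suffices T = lo C g from this ▸ hmem
  refine subset_antisymm hsub fun k hk => ?_
  by_contra hkT
  have h2 := hmin k (by simp [hkT])
  have h3 : lo C k ⊂ lo C g := by
    refine (ssubset_iff_of_subset fun z hz => ?_).2 ⟨k, hk, notMem_lo⟩
    obtain ⟨S, hS, hkS, hzS⟩ := mem_lo.1 hz
    rcases hC.total S hS _ hmem with h4 | h4
    · exact h4 hzS
    · exact absurd (h4 hk) hkS
  exact absurd (card_lt_card h3) (by omega)

lemma amp_concave : Amp (concave E) := by
  intro C hC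
  classical
  set b : E → E → ℝ := fun e g => if e ∈ lo C g then 1 else 0 with hb
  have hb1 : ∀ e g, b e g ≤ 1 := fun e g => by simp only [hb]; split_ifs <;> norm_num
  have hb0 : ∀ e g, 0 ≤ b e g := fun e g => by simp only [hb]; split_ifs <;> norm_num
  set l : E → ℝ := fun e => ∑ g, (b e g - b g e) with hl
  have key : ∀ T : Finset E, modular 0 l T =
      concave E T - ∑ e ∈ T, ∑ g ∈ Tᶜ, (b g e + (1 - b e g)) := by
    intro T
    have h1 : ∀ e, l e = ∑ g ∈ T, (b e g - b g e) + ∑ g ∈ Tᶜ, (b e g - b g e) := fun e =>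
      (sum_add_sum_compl _ _).symm
    have h2 : ∑ e ∈ T, ∑ g ∈ T, (b e g - b g e) = 0 := by
      simp only [sum_sub_distrib]
      rw [sum_comm (f := fun e g => b g e), sub_self]
    have h3 : ∑ e ∈ T, ∑ g ∈ Tᶜ, (1 : ℝ) = concave E T := by
      simp [concave, card_compl, Nat.cast_sub (card_le_univ T)]
      ring
    rw [← h3, ← sum_sub_distrib, modular, zero_add]
    simp only [h1, sum_add_distrib (s := T)]
    rw [h2, zero_add]
    refine sum_congr rfl fun e _ => ?_
    rw [← sum_sub_distrib]
    exact sum_congr rfl fun g _ => by ring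
  refine ⟨0, l, ⟨fun T hT => ?_, ?_, ?_⟩, fun T h1 h2 h3 => ?_⟩
  · rw [key, sum_eq_zero, sub_zero]
    refine fun e he => sum_eq_zero fun g hg => ?_
    rw [mem_compl] at hg
    have e1 : e ∈ lo C g := subset_lo hT hg he
    have e2 : g ∉ lo C e := by
      intro hge
      obtain ⟨S, hS, heS, hgS⟩ := mem_lo.1 hge
      rcases hC.total S hS T hT with h | h
      · exact hg (h hgS)
      · exact heS (h he)
    simp [hb, e1, e2]
  · rw [key]; simp
  · rw [key]; simp
  · rw [key, sub_lt_self_iff]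
    have hnn : ∀ e g, 0 ≤ b g e + (1 - b e g) := fun e g => by linarith [hb1 e g, hb0 g e]
    have : ∃ e ∈ T, ∃ g, g ∉ T ∧ e ∉ lo C g := by
      by_contra! hcon
      exact h1 (mem_of_forall_mem_lo hC h2 h3 hcon)
    obtain ⟨e, he, g, hg, heg⟩ := this
    refine sum_pos' (fun e _ => sum_nonneg fun g _ => hnn e g) ⟨e, he, ?_⟩
    refine sum_pos' (fun g _ => hnn e g) ⟨g, mem_compl.2 hg, ?_⟩
    have := hb0 g e
    have : b e g = 0 := by simp [hb, heg]
    linarith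

lemma continuous_deg {G : ℝ → Finset (Finset E) → E → ℝ} (h : ∀ ω f, Continuous fun ε => G ε ω f) :
    Continuous fun ε => deg t v W C (G ε) := by
  simp only [deg, chainSum_apply, loc]
  fun_prop

/-- The degree of `α ^ i * τ ^ j`, with `α` the class of `-ind ∅` and `τ` the class `(0, 1)`. -/
noncomputable def bideg (t : E → ℝ) (v : E → X) (W : Submodule ℝ X) (C : Finset (Finset E))
    (i j : ℕ) : ℝ :=
  deg t v W C fun ω f => lin t ω (-ind ∅) ^ i * t f ^ j

theorem bideg_logConcave (ht : Function.Injective t) [Nonempty E] (h : HasRank v W r) (hr : 1 ≤ r)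
    {i j : ℕ} (hd : i + j + 4 = Fintype.card E + r) :
    bideg t v W ∅ (i + 2) j * bideg t v W ∅ i (j + 2) ≤ bideg t v W ∅ (i + 1) (j + 1) ^ 2 := by
  set a : ℝ → (Finset E → ℝ) × ℝ := fun ε => (-ind ∅ + ε • concave E, ε) with ha
  set b : ℝ → (Finset E → ℝ) × ℝ := fun ε => (ε • concave E, 1) with hb
  set F : ℕ → ℕ → ℝ → ℝ := fun i j ε =>
    deg t v W ∅ fun ω f => ell t (a ε) ω f ^ i * ell t (b ε) ω f ^ j with hF
  have hcont : ∀ i j, Continuous (F i j) := fun i j => by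
    refine continuous_deg fun ω f => ?_
    simp only [ell, ha, hb, map_add, map_smul, smul_eq_mul]
    fun_prop
  have h0 : ∀ i j, F i j 0 = bideg t v W ∅ i j := fun i j => by
    simp [hF, ha, hb, ell, bideg]
  have hpos : ∀ ε ∈ Set.Ioi (0 : ℝ), F (i + 2) j ε * F i (j + 2) ε ≤ F (i + 1) (j + 1) ε ^ 2 := by
    intro ε (hε : 0 < ε)
    have hA : Ample (a ε) := ⟨nef_neg_ind_empty.add_amp (amp_concave.smul hε), hε⟩
    have hB : Ample (b ε) := ⟨amp_concave.smul hε, one_pos⟩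
    have key := mix_hyperbolic (ws := List.replicate i (a ε) ++ List.replicate j (b ε)) ht
      isProperChain_empty h hr (by simp; omega) (by
        intro z hz
        rw [List.mem_append, List.mem_replicate, List.mem_replicate] at hz
        rcases hz with hz | hz
        · rw [hz.2]; exact hA
        · rw [hz.2]; exact hB) hB (a ε)
    convert key using 2
    · exact deg_congr fun ω _ _ f _ => by simp; ring
    · exact deg_congr fun ω _ _ f _ => by simp; ring
    · exact deg_congr fun ω _ _ f _ => by simp; ring
  have hclosed : IsClosed {ε | F (i + 2) j ε * F i (j + 2) ε ≤ F (i + 1) (j + 1) ε ^ 2} :=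
    isClosed_le ((hcont _ _).mul (hcont _ _)) ((hcont _ _).pow 2)
  have := hclosed.closure_subset_iff.2 hpos
    (by rw [closure_Ioi]; exact Set.self_mem_Ici : (0 : ℝ) ∈ closure (Set.Ioi 0))
  simpa only [Set.mem_ofPred_eq, h0] using this

end Cone

section Saturated

variable {E : Type*} [Fintype E] [DecidableEq E]

/-- `C` is a saturated chain from `D` to `univ`, with `univ` removed. -/
structure IsTop (C : Finset (Finset E)) (D : Finset E) : Prop where
  chain : IsProperChain C
  mem : D ∈ C ∨ D = univ
  subset : ∀ S ∈ C, D ⊆ S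
  card : C.card + D.card = Fintype.card E
  saturated : ∀ T, (∀ S ∈ C, S ⊆ T ∨ T ⊆ S) → T ⊆ D ∨ T ∈ C ∨ T = univ

variable {X : Type*} [AddCommGroup X] [Module ℝ X]
  {t : E → ℝ} {v : E → X} {W : Submodule ℝ X} {C ω : Finset (Finset E)} {D S T : Finset E}
  {a b e f : E} {g : Finset (Finset E) → E → ℝ} {r i j : ℕ}

lemma isTop_univ : IsTop (∅ : Finset (Finset E)) univ :=
  ⟨isProperChain_empty, Or.inr rfl, by simp, by simp, by simp⟩

lemma IsTop.ssubset (h : IsTop C D) (hT : T ∈ comp C) : T ⊂ D := by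
  obtain ⟨h1, -, h3, h4⟩ := (mem_comp_iff h.chain).1 hT
  have h5 : T ⊆ D := by
    rcases h.saturated T h4 with h' | h' | h'
    · exact h'
    · exact absurd h' h1
    · exact absurd h' h3
  refine h5.ssubset_of_ne ?_
  rintro rfl
  rcases h.mem with h' | h'
  · exact h1 h'
  · exact h3 h'

lemma IsTop.mem_comp_of_ssubset (h : IsTop C D) (hT : T ⊂ D) (h0 : T ≠ ∅) : T ∈ comp C := by
  refine (mem_comp_iff h.chain).2 ⟨fun hh => hT.2 (h.subset T hh), h0, ?_, fun S hS =>
    Or.inr (hT.1.trans (h.subset S hS))⟩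
  rintro rfl
  exact hT.2 (subset_univ _)

lemma IsTop.erase (h : IsTop C D) (he : e ∈ D) (h0 : D.erase e ≠ ∅) :
    IsTop (insert (D.erase e) C) (D.erase e) := by
  have hc := h.mem_comp_of_ssubset (erase_ssubset he) h0
  refine ⟨(mem_comp.1 hc).2, Or.inl (mem_insert_self _ _), ?_, ?_, fun T hT => ?_⟩
  · intro S hS
    rcases mem_insert.1 hS with rfl | hS
    · exact Subset.rfl
    · exact (erase_subset _ _).trans (h.subset S hS)
  · have := h.card
    have := card_pos.2 ⟨e, he⟩
    rw [card_insert_of_notMem (mem_comp.1 hc).1, card_erase_of_mem he]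
    omega
  · rw [mem_insert]
    rcases h.saturated T fun S hS => hT S (mem_insert_of_mem hS) with h1 | h1 | h1
    · rcases hT _ (mem_insert_self _ _) with h2 | h2
      · by_cases heT : e ∈ T
        · have : T = D := h1.antisymm fun x hx => by
            by_cases hxe : x = e
            · exact hxe ▸ heT
            · exact h2 (mem_erase.2 ⟨hxe, hx⟩)
          rw [this]
          rcases h.mem with h3 | h3
          · exact Or.inr (Or.inl (Or.inr h3))
          · exact Or.inr (Or.inr h3)
        · exact Or.inl (subset_erase.2 ⟨h1, heT⟩)
      · exact Or.inl h2
    · exact Or.inr (Or.inl (Or.inr h1))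
    · exact Or.inr (Or.inr h1)

lemma IsTop.unsep (h : IsTop C D) (hT : T ⊂ D) (ha : a ∈ D) (hb : b ∈ D) (haT : a ∉ T)
    (hbT : b ∉ T) : Unsep (insert T C) a b := by
  intro S hS
  rcases mem_insert.1 hS with rfl | hS
  · simp [haT, hbT]
  · simp [h.subset S hS ha, h.subset S hS hb]

lemma lin_neg_ind_empty (hω : ω ∈ maxChains E) (ha : ∀ T ∈ ω, a ∈ T) :
    lin t ω (-ind ∅) = t a := by
  have hlo : lo ω a = ∅ := by
    rw [eq_empty_iff_forall_notMem]
    intro x hx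
    obtain ⟨T, hT, h, -⟩ := mem_lo.1 hx
    exact h (ha T hT)
  have h1 : ∀ e, ind ∅ (hi ω e) = 0 := fun e => by
    simp [ind, hi]
  have h2 : ∀ e, ind ∅ (lo ω e) = if e = a then 1 else 0 := fun e => by
    by_cases h : e = a
    · subst h; simp [ind, hlo]
    · have : lo ω e ≠ ∅ := fun h' => h (lo_injective hω (h'.trans hlo.symm))
      simp [ind, h, this]
  rw [lin_apply]
  simp only [Pi.neg_apply, h1, h2]
  simp

lemma exists_mem_all [Nonempty E] (hω : ω ∈ maxChains E) : ∃ a, ∀ T ∈ ω, a ∈ T := by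
  obtain ⟨a, ha⟩ := exists_lo_eq hω (Or.inr rfl)
  refine ⟨a, fun T hT => ?_⟩
  by_contra h
  have := subset_lo hT h
  rw [ha, subset_empty] at this
  exact (mem_maxChains.1 hω).1.empty_notMem (this ▸ hT)

/-- Exchanging two elements above a nonempty member does not change the first element. -/
lemma lin_neg_ind_empty_swap (hT : T ∈ C)
    (hbT : b ∉ T) (ha : insert (hi C a) C ∈ maxChains E) (hb : insert (hi C b) C ∈ maxChains E) :
    lin t (insert (hi C a) C) (-ind ∅) = lin t (insert (hi C b) C) (-ind ∅) := by
  have : Nonempty E := ⟨a⟩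
  obtain ⟨x, hx⟩ := exists_mem_all ha
  rw [lin_neg_ind_empty ha hx, lin_neg_ind_empty (a := x) hb]
  intro S hS
  have hxT := hx T (mem_insert_of_mem hT)
  rcases mem_insert.1 hS with rfl | hS
  · exact mem_insert_of_mem (subset_lo hT hbT hxT)
  · exact hx S (mem_insert_of_mem hS)

lemma lo_insert : lo (insert T C) f = if f ∈ T then lo C f else lo C f ∪ T := by
  ext x
  split_ifs with h
  · simp only [mem_lo, mem_insert]
    constructor
    · rintro ⟨S, rfl | hS, h1, h2⟩
      · exact absurd h h1
      · exact ⟨S, hS, h1, h2⟩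
    · rintro ⟨S, hS, h1, h2⟩
      exact ⟨S, Or.inr hS, h1, h2⟩
  · rw [mem_union]
    simp only [mem_lo, mem_insert]
    constructor
    · rintro ⟨S, rfl | hS, h1, h2⟩
      · exact Or.inr h2
      · exact Or.inl ⟨S, hS, h1, h2⟩
    · rintro (⟨S, hS, h1, h2⟩ | h1)
      · exact ⟨S, Or.inr hS, h1, h2⟩
      · exact ⟨T, Or.inl rfl, h, h1⟩

/-- In a chain of corank one with unseparated pair `a, b`, other elements are above or below. -/
lemma mem_lo_of_unsep (hab : Unsep C a b) (hne : a ≠ b) (ha : insert (hi C a) C ∈ maxChains E)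
    (hfa : f ≠ a) (hfb : f ≠ b) (hf : f ∉ lo C a) : insert a (insert b (lo C a)) ⊆ lo C f := by
  obtain ⟨T, hT, hsep⟩ : ∃ T ∈ insert (hi C a) C, ¬ (f ∈ T ↔ b ∈ T) := by
    simpa only [Unsep, not_forall, exists_prop] using exists_sep ha hfb
  have hb : b ∉ hi C a := by
    rw [hi, mem_insert, hab.lo_eq, not_or]
    exact ⟨hne.symm, notMem_lo⟩
  have hf' : f ∉ hi C a := by
    rw [hi, mem_insert, not_or]
    exact ⟨hfa, hf⟩
  have hTC : T ∈ C := by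
    rcases mem_insert.1 hT with rfl | h
    · exact absurd (by simp [hb, hf']) hsep
    · exact h
  have hfT : f ∉ T := fun h => by
    have haT : a ∉ T := fun h' => hsep (by simp [h, (hab T hTC).1 h'])
    exact hf (subset_lo hTC haT h)
  have hbT : b ∈ T := by
    by_contra h
    exact hsep (by simp [h, hfT])
  refine insert_subset (subset_lo hTC hfT ((hab T hTC).2 hbT))
    (insert_subset (subset_lo hTC hfT hbT) fun x hx => ?_)
  obtain ⟨S, hS, haS, hxS⟩ := mem_lo.1 hx
  exact mem_lo.2 ⟨S, hS, fun h => hf (subset_lo hS haS h), hxS⟩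

lemma bas_swap (hab : Unsep C a b) (hne : a ≠ b) (ha : insert (hi C a) C ∈ maxChains E)
    (hcl : v a ∈ clo v W (lo C a)) :
    bas v W (insert (hi C a) C) = bas v W (insert (hi C b) C) := by
  have hL := hab.lo_eq
  have hbL : b ∉ lo C a := hL ▸ notMem_lo
  have haL : a ∉ lo C a := notMem_lo
  ext f
  rw [mem_bas, mem_bas, not_iff_not, lo_insert, lo_insert]
  by_cases hfa : f = a
  · subst hfa
    have h1 : f ∉ hi C b := by
      rw [hi, mem_insert, not_or, ← hL]
      exact ⟨hne, haL⟩
    rw [if_pos self_mem_hi, if_neg h1]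
    exact iff_of_true hcl (clo_mono subset_union_left hcl)
  by_cases hfb : f = b
  · subst hfb
    have h1 : f ∉ hi C a := by
      rw [hi, mem_insert, not_or]
      exact ⟨hfa, hbL⟩
    rw [if_pos self_mem_hi, if_neg h1, hi, ← hL, union_insert, union_self, clo_insert,
      sup_span_eq hcl]
  have hm : ∀ c, c ≠ f → lo C c = lo C a → (f ∈ hi C c ↔ f ∈ lo C a) := fun c hc h => by
    rw [hi, mem_insert, h]
    exact or_iff_right fun h => hc h.symm
  simp only [hm a (Ne.symm hfa) rfl, hm b (Ne.symm hfb) hL.symm]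
  split_ifs with h
  · rfl
  · have h2 := mem_lo_of_unsep hab hne ha hfa hfb h
    have h3 : hi C a ⊆ lo C f := (insert_subset_insert _ (subset_insert _ _)).trans h2
    have h4 : hi C b ⊆ lo C f := by
      rw [hi, ← hL]
      exact (subset_insert _ _).trans h2
    rw [union_eq_left.2 h3, union_eq_left.2 h4]

lemma hi_mem_maxChains (hC : IsProperChain C) (hcard : C.card + 2 = Fintype.card E) (hne : a ≠ b)
    (hab : Unsep C a b) :
    insert (hi C a) C ∈ maxChains E ∧ insert (hi C b) C ∈ maxChains E := by
  have := comp_eq_pair hC hcard hne hab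
  exact ⟨insert_mem_maxChains hcard (by simp [this]), insert_mem_maxChains hcard (by simp [this])⟩

lemma IsTop.bideg_insert_eq_zero (ht : Function.Injective t) (h : IsTop C D) (hT : T ⊂ D)
    (h0 : T ≠ ∅) (he : e ∈ D) (hf : f ∈ D) (heT : e ∉ T) (hfT : f ∉ T) (hne : e ≠ f)
    (hbas : v e ∈ clo v W T ∨ HasRank v W 1 ∧ j = 0) : bideg t v W (insert T C) i j = 0 := by
  refine chainSum_eq_zero_of_swap ht (mem_comp.1 (h.mem_comp_of_ssubset hT h0)).2 hne
    (h.unsep hT he hf heT hfT) fun C' hC' hsub hcard b hb hu => ?_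
  have hTC : T ∈ C' := hsub (mem_insert_self _ _)
  obtain ⟨h1, h2⟩ := hi_mem_maxChains hC' hcard hb.symm hu
  have hlin := lin_neg_ind_empty_swap (t := t) hTC (fun h => heT ((hu T hTC).2 h)) h1 h2
  rcases hbas with hcl | ⟨hr, rfl⟩
  · have := bas_swap hu hb.symm h1 (clo_mono (subset_lo hTC heT) hcl)
    simp only [loc, this, hlin]
  · have key : ∀ ω ∈ maxChains E, loc t v W (fun ω f => lin t ω (-ind ∅) ^ i * t f ^ 0) ω =
        lin t ω (-ind ∅) ^ i := fun ω hω => by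
      have := loc_mul_left (t := t) (v := v) (W := W) (ω := ω) (g := fun _ _ => 1)
        fun ω => lin t ω (-ind ∅) ^ i
      rw [hr.loc_one hω] at this
      simpa using this
    rw [key _ h1, key _ h2, hlin]

lemma bideg_eq_mix : bideg t v W C i j =
    mix t v W C (List.replicate i (-ind ∅, 0) ++ List.replicate j (0, 1)) := by
  simp [bideg, mix, ell]

lemma IsTop.bideg_succ (ht : Function.Injective t) (h : IsTop C D) (he : e ∈ D) (heW : v e ∉ W)
    (hr : HasRank v W r) (hd : i + j + 3 = D.card + r) :
    bideg t v W C i (j + 1) = bideg t v (W ⊔ Submodule.span ℝ {v e}) C i j +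
      cle v W e (D.erase e) * bideg t v W (insert (D.erase e) C) i j := by
  have : Nonempty E := ⟨e⟩
  have hcard := h.card
  have hmix : bideg t v W C i (j + 1) =
      mix t v W C ((0, 1) :: (List.replicate i (-ind ∅, 0) ++ List.replicate j (0, 1))) := by
    rw [bideg_eq_mix]
    refine mix_perm ?_
    rw [List.replicate_succ]
    exact List.perm_middle
  rw [hmix, mix_cons_eq (c := 0) (l := 0) ht h.chain hr (by simp; omega) heW
    (fun S hS _ => h.subset S hS he)
    ⟨fun _ _ => by simp [modular], by simp [modular], by simp [modular]⟩]
  simp only [← bideg_eq_mix, one_mul]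
  congr 1
  have hcoef : ∀ T : Finset E, coef v W e 0 0 (0, 1) T = cle v W e T - if e ∈ T then 1 else 0 := by
    intro T; simp [coef, modular]
  simp only [hcoef]
  rw [sum_eq_single (D.erase e)]
  · simp
  · intro T hT hne
    by_cases heT : e ∈ T
    · simp [heT, cle_of_mem heT]
    by_cases hcl : v e ∈ clo v W T
    swap
    · simp [heT, cle, hcl]
    have hTD := h.ssubset hT
    obtain ⟨f, hf, hfT⟩ := exists_of_ssubset
      ((subset_erase.2 ⟨hTD.1, heT⟩).ssubset_of_ne hne)
    rw [h.bideg_insert_eq_zero ht hTD ((mem_comp_iff h.chain).1 hT).2.1 he (mem_of_mem_erase hf) heT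
      hfT (ne_of_mem_erase hf).symm (Or.inl hcl), mul_zero]
  · intro hT
    have h0 : D.erase e = ∅ := by
      by_contra h0
      exact hT (h.mem_comp_of_ssubset (erase_ssubset he) h0)
    simp [h0, cle_empty heW]

lemma IsTop.bideg_zero_eq_one (ht : Function.Injective t) (h : IsTop C D) (hr : HasRank v W 1)
    (hi : i + 1 = D.card) : bideg t v W C i 0 = 1 := by
  have hcard := h.card
  induction i generalizing C D with
  | zero =>
    have hC : C ∈ maxChains E := mem_maxChains.2 ⟨h.chain, by omega⟩
    rw [bideg, deg, chainSum_of_mem_maxChains hC]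
    simpa using hr.loc_one hC
  | succ i ih =>
    obtain ⟨e, he⟩ := card_pos.1 (by omega : 0 < D.card)
    have : Nonempty E := ⟨e⟩
    obtain ⟨e₀, he₀, hC₀⟩ := exists_generic h.chain hr
    have hmod : ∀ T : Finset E, modular (-1) (Pi.single e 1 : E → ℝ) T =
        if e ∈ T then 0 else -1 := by
      intro T
      simp only [modular, Pi.single_apply, sum_ite_eq']
      split_ifs <;> norm_num
    have hind : ∀ T : Finset E, T ≠ ∅ → ind (∅ : Finset E) T = 0 := fun T hT => by simp [ind, hT]
    have hmix : bideg t v W C (i + 1) 0 =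
        mix t v W C ((-ind ∅, 0) :: (List.replicate i (-ind ∅, 0) ++ List.replicate 0 (0, 1))) := by
      rw [bideg_eq_mix]
      rfl
    have h0 : D.erase e ≠ ∅ := card_ne_zero.1 (by rw [card_erase_of_mem he]; omega) |>.ne_empty
    have hinterp : Interpolates C (-ind ∅) (-1) (Pi.single e 1 : E → ℝ) := by
      refine ⟨fun S hS => ?_, ?_, ?_⟩
      · have heS := h.subset S hS he
        simp [hmod, heS, hind S (ne_empty_of_mem heS)]
      · simp [hmod, ind]
      · simp [hmod, hind _ univ_nonempty.ne_empty]
    rw [hmix, mix_cons_eq (c := -1) (l := Pi.single e 1) ht h.chain hr (by simp; omega) he₀ hC₀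
      hinterp]
    simp only [← bideg_eq_mix, zero_mul, zero_add]
    rw [sum_eq_single (D.erase e)]
    · have hcard' : (D.erase e).card = i + 1 := by rw [card_erase_of_mem he]; omega
      rw [ih (h.erase he h0) hcard'.symm (h.erase he h0).card]
      simp [coef, hmod, hind _ h0]
    · intro T hT hne
      have hT0 := ((mem_comp_iff h.chain).1 hT).2.1
      by_cases heT : e ∈ T
      · simp [coef, hmod, hind _ hT0, heT]
      have hTD := h.ssubset hT
      obtain ⟨f, hf, hfT⟩ := exists_of_ssubset
        ((subset_erase.2 ⟨hTD.1, heT⟩).ssubset_of_ne hne)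
      rw [h.bideg_insert_eq_zero ht hTD hT0 he (mem_of_mem_erase hf) heT
        hfT (ne_of_mem_erase hf).symm (Or.inr ⟨hr, rfl⟩), mul_zero]
    · intro hT
      exact absurd (h.mem_comp_of_ssubset (erase_ssubset he) h0) hT

lemma bideg_zero_eq_zero (ht : Function.Injective t) (hr : HasRank v W r) (h2 : 2 ≤ r) :
    bideg t v W C i 0 = 0 := by
  rw [bideg, deg, chainSum_congr (H := 0), map_zero]
  intro ω hω _
  simp only [loc, pow_zero, mul_one]
  rw [← sum_mul, sum_lag_eq_zero ht (by rw [hr ω hω]; exact h2), zero_mul, Pi.zero_apply]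

end Saturated

section Graph

variable {V E : Type*} [Fintype V] [DecidableEq V] [Fintype E] [DecidableEq E] (p q : E → V)

/-- The edge `e` joins `i` to `j`. -/
def Joins (e : E) (i j : V) : Prop := p e = i ∧ q e = j ∨ p e = j ∧ q e = i

open Classical in
/-- The number of edges in `D` joining `i` to a vertex outside `I`. -/
noncomputable def outDeg (D : Finset E) (I : Finset V) (i : V) : ℕ :=
  (D.filter fun e => ∃ j ∉ I, Joins p q e i j).card

/-- Parking functions for the graph with edge set `D` and sink `U`. -/
structure IsParking (U : Finset V) (D : Finset E) (a : V → ℕ) : Prop where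
  eq_zero : ∀ i ∈ U, a i = 0
  pos : ∀ i ∉ U, 1 ≤ a i
  exists_le : ∀ I : Finset V, I.Nonempty → Disjoint I U → ∃ i ∈ I, a i ≤ outDeg p q D I i

open Classical in
/-- The number of parking functions with sum `s`. -/
noncomputable def parkCount (U : Finset V) (D : Finset E) (s : ℕ) : ℕ :=
  ((piAntidiag univ s).filter (IsParking p q U D)).card

/-- The vector of an edge. -/
noncomputable def edgeVec (e : E) : V → ℝ := Pi.single (p e) 1 - Pi.single (q e) 1

/-- The coordinate subspace of `U`. -/
noncomputable def coordSpan (U : Finset V) : Submodule ℝ (V → ℝ) :=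
  Submodule.span ℝ ((fun u => Pi.single u 1) '' U)

variable {p q} {U I : Finset V} {D : Finset E} {e : E} {i j u : V} {a : V → ℕ} {s r : ℕ}

lemma IsParking.eq_zero_of_univ (h : IsParking p q univ D a) : a = 0 :=
  funext fun i => h.eq_zero i (mem_univ i)

lemma IsParking.card_le_sum (h : IsParking p q U D a) : Uᶜ.card ≤ ∑ i, a i := by
  rw [card_eq_sum_ones]
  exact (sum_le_sum fun i hi => h.pos i (mem_compl.1 hi)).trans
    (sum_le_sum_of_subset (subset_univ _))

lemma mem_parkCount [DecidablePred (IsParking p q U D)] :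
    a ∈ (piAntidiag univ s).filter (IsParking p q U D) ↔ ∑ i, a i = s ∧ IsParking p q U D a := by
  simp [mem_piAntidiag]

lemma parkCount_eq_zero (h : ∀ a, IsParking p q U D a → ∑ i, a i ≠ s) :
    parkCount p q U D s = 0 := by
  classical
  rw [parkCount, card_eq_zero, filter_eq_empty_iff]
  intro a ha hp
  exact h a hp (mem_piAntidiag.1 ha).1

lemma parkCount_univ (hs : s ≠ 0) : parkCount p q univ D s = 0 :=
  parkCount_eq_zero fun a ha => by rw [ha.eq_zero_of_univ]; simpa using hs.symm

lemma outDeg_eq_card [DecidablePred fun e => ∃ j ∉ I, Joins p q e i j] :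
    outDeg p q D I i = (D.filter fun e => ∃ j ∉ I, Joins p q e i j).card := by
  unfold outDeg
  congr

lemma outDeg_erase_of_ne (he : Joins p q e i u) (hij : j ≠ i) (hju : j ≠ u) :
    outDeg p q (D.erase e) I j = outDeg p q D I j := by
  classical
  rw [outDeg, outDeg, filter_erase, erase_eq_of_notMem]
  rw [mem_filter]
  rintro ⟨-, k, -, h⟩
  unfold Joins at h he
  grind

lemma outDeg_erase_self (he : Joins p q e i u) (heD : e ∈ D) (hu : u ∉ I) :
    outDeg p q (D.erase e) I i + 1 = outDeg p q D I i := by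
  classical
  rw [outDeg, outDeg, filter_erase, card_erase_add_one]
  exact mem_filter.2 ⟨heD, u, hu, he⟩

lemma isParking_add_single_iff_erase (he : Joins p q e i u) (heD : e ∈ D) (hu : u ∈ U)
    (hi : i ∉ U) (ha : 1 ≤ a i) :
    IsParking p q U D (a + Pi.single i 1) ↔ IsParking p q U (D.erase e) a := by
  have hne : ∀ j, j ≠ i → (a + Pi.single i 1 : V → ℕ) j = a j := fun j hj => by simp [hj]
  have hself : (a + Pi.single i 1 : V → ℕ) i = a i + 1 := by simp
  have hU : ∀ j ∈ U, (a + Pi.single i 1 : V → ℕ) j = a j := fun j hj =>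
    hne j fun h => hi (h ▸ hj)
  have hle : ∀ I : Finset V, Disjoint I U → ∀ j ∈ I,
      ((a + Pi.single i 1 : V → ℕ) j ≤ outDeg p q D I j ↔ a j ≤ outDeg p q (D.erase e) I j) := by
    intro I hI j hj
    have huI : u ∉ I := fun h => disjoint_left.1 hI h hu
    by_cases hji : j = i
    · subst hji
      rw [hself, ← outDeg_erase_self he heD huI]
      omega
    · rw [hne j hji, outDeg_erase_of_ne he hji fun h => huI (h ▸ hj)]
  constructor
  · intro h
    refine ⟨fun j hj => hU j hj ▸ h.eq_zero j hj, fun j hj => ?_, fun I hI hd => ?_⟩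
    · by_cases hji : j = i
      · exact hji ▸ ha
      · exact hne j hji ▸ h.pos j hj
    · obtain ⟨j, hj, hj'⟩ := h.exists_le I hI hd
      exact ⟨j, hj, (hle I hd j hj).1 hj'⟩
  · intro h
    refine ⟨fun j hj => (hU j hj).trans (h.eq_zero j hj), fun j hj => ?_, fun I hI hd => ?_⟩
    · exact (h.pos j hj).trans (by simp)
    · obtain ⟨j, hj, hj'⟩ := h.exists_le I hI hd
      exact ⟨j, hj, (hle I hd j hj).2 hj'⟩

lemma isParking_add_single_iff_insert (he : Joins p q e i u) (heD : e ∈ D) (hu : u ∈ U)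
    (hi : i ∉ U) (ha : a i = 0) :
    IsParking p q U D (a + Pi.single i 1) ↔ IsParking p q (insert i U) D a := by
  have hne : ∀ j, j ≠ i → (a + Pi.single i 1 : V → ℕ) j = a j := fun j hj => by simp [hj]
  have hself : (a + Pi.single i 1 : V → ℕ) i = 1 := by simp [ha]
  have hU : ∀ j ∈ U, (a + Pi.single i 1 : V → ℕ) j = a j := fun j hj =>
    hne j fun h => hi (h ▸ hj)
  constructor
  · intro h
    refine ⟨fun j hj => ?_, fun j hj => ?_, fun I hI hd => ?_⟩
    · rcases mem_insert.1 hj with rfl | hj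
      · exact ha
      · exact hU j hj ▸ h.eq_zero j hj
    · rw [mem_insert, not_or] at hj
      exact hne j hj.1 ▸ h.pos j hj.2
    · rw [disjoint_insert_right] at hd
      obtain ⟨j, hj, hj'⟩ := h.exists_le I hI hd.2
      exact ⟨j, hj, hne j (fun h => hd.1 (h ▸ hj)) ▸ hj'⟩
  · intro h
    refine ⟨fun j hj => (hU j hj).trans (h.eq_zero j (mem_insert_of_mem hj)), fun j hj => ?_,
      fun I hI hd => ?_⟩
    · by_cases hji : j = i
      · rw [hji, hself]
      · rw [hne j hji]
        exact h.pos j (by simp [hji, hj])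
    · by_cases hiI : i ∈ I
      · refine ⟨i, hiI, ?_⟩
        rw [hself, ← outDeg_erase_self he heD fun h => disjoint_left.1 hd h hu]
        omega
      · obtain ⟨j, hj, hj'⟩ := h.exists_le I hI (disjoint_insert_right.2 ⟨hiI, hd⟩)
        exact ⟨j, hj, (hne j fun h => hiI (h ▸ hj)).trans_le hj'⟩

lemma isParking_add_single_iff (he : Joins p q e i u) (heD : e ∈ D) (hu : u ∈ U) (hi : i ∉ U) :
    IsParking p q U D (a + Pi.single i 1) ↔
      IsParking p q U (D.erase e) a ∨ IsParking p q (insert i U) D a := by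
  rcases Nat.eq_zero_or_pos (a i) with ha | ha
  · rw [isParking_add_single_iff_insert he heD hu hi ha, or_iff_right]
    intro h
    have := h.pos i hi
    omega
  · rw [isParking_add_single_iff_erase he heD hu hi ha, or_iff_left]
    intro h
    have := h.eq_zero i (mem_insert_self _ _)
    omega

lemma parkCount_succ (he : Joins p q e i u) (heD : e ∈ D) (hu : u ∈ U) (hi : i ∉ U) (s : ℕ) :
    parkCount p q U D (s + 1) =
      parkCount p q U (D.erase e) s + parkCount p q (insert i U) D s := by
  classical
  simp only [parkCount]
  rw [← card_union_of_disjoint]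
  · rw [← card_image_of_injective (_ ∪ _) (add_left_injective (Pi.single i 1 : V → ℕ))]
    congr 1
    ext a
    rw [mem_image]
    simp only [mem_union, mem_parkCount]
    constructor
    · rintro ⟨hs, ha⟩
      have hle : Pi.single i 1 ≤ a := by
        intro j
        by_cases hj : j = i
        · subst hj
          simpa using ha.pos j hi
        · simp [hj]
      obtain ⟨b, rfl⟩ := exists_add_of_le hle
      rw [add_comm] at hs ha
      have hs' : ∑ j, b j = s := by
        simpa [sum_add_distrib] using hs
      refine ⟨b, ?_, add_comm _ _⟩
      rw [isParking_add_single_iff he heD hu hi] at ha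
      exact ha.imp (fun h => ⟨hs', h⟩) fun h => ⟨hs', h⟩
    · rintro ⟨b, hb, rfl⟩
      refine ⟨?_, (isParking_add_single_iff he heD hu hi).2 (hb.imp And.right And.right)⟩
      have hs' : ∑ j, b j = s := hb.elim And.left And.left
      simp [sum_add_distrib, hs']
  · rw [disjoint_left]
    intro b hb hb'
    rw [mem_parkCount] at hb hb'
    have := hb.2.pos i hi
    have := hb'.2.eq_zero i (mem_insert_self _ _)
    omega

lemma edgeVec_eq_or (he : Joins p q e i j) :
    edgeVec p q e = Pi.single i 1 - Pi.single j 1 ∨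
      edgeVec p q e = -(Pi.single i 1 - Pi.single j 1) := by
  rcases he with ⟨rfl, rfl⟩ | ⟨rfl, rfl⟩
  · exact Or.inl rfl
  · exact Or.inr (by simp [edgeVec])

lemma single_mem_of_joins {W : Submodule ℝ (V → ℝ)} (he : Joins p q e i j)
    (hW : edgeVec p q e ∈ W) (hj : Pi.single j 1 ∈ W) : Pi.single i 1 ∈ W := by
  have : (Pi.single i 1 - Pi.single j 1 : V → ℝ) ∈ W := by
    rcases edgeVec_eq_or he with h | h
    · rwa [h] at hW
    · rwa [h, neg_mem_iff] at hW
  simpa using W.add_mem this hj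

lemma single_mem_coordSpan (hu : u ∈ U) : Pi.single u 1 ∈ coordSpan U :=
  Submodule.subset_span ⟨u, by exact_mod_cast hu, rfl⟩

lemma edgeVec_mem_of_single_mem {W : Submodule ℝ (V → ℝ)} (he : Joins p q e i j)
    (hi : Pi.single i 1 ∈ W) (hj : Pi.single j 1 ∈ W) : edgeVec p q e ∈ W := by
  rcases edgeVec_eq_or he with h | h
  · rw [h]; exact W.sub_mem hi hj
  · rw [h]; exact W.neg_mem (W.sub_mem hi hj)

lemma coordSpan_insert (he : Joins p q e i u) (hu : u ∈ U) :
    coordSpan (insert i U) = coordSpan U ⊔ Submodule.span ℝ {edgeVec p q e} := by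
  apply le_antisymm
  · rw [coordSpan, Submodule.span_le]
    rintro _ ⟨j, hj, rfl⟩
    rcases mem_insert.1 (by exact_mod_cast hj : j ∈ insert i U) with rfl | hj
    · exact single_mem_of_joins he
        (Submodule.mem_sup_right (Submodule.mem_span_singleton_self _))
        (Submodule.mem_sup_left (single_mem_coordSpan hu))
    · exact Submodule.mem_sup_left (single_mem_coordSpan hj)
  · refine sup_le (Submodule.span_mono (Set.image_mono (by simp))) ?_
    rw [Submodule.span_singleton_le_iff_mem]
    exact edgeVec_mem_of_single_mem he (single_mem_coordSpan (mem_insert_self _ _))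
      (single_mem_coordSpan (mem_insert_of_mem hu))

lemma coordSpan_le_ker : coordSpan U ≤
    LinearMap.ker (∑ j ∈ Uᶜ, (LinearMap.proj j : (V → ℝ) →ₗ[ℝ] ℝ)) := by
  rw [coordSpan, Submodule.span_le]
  rintro _ ⟨j, hj, rfl⟩
  have hj' : j ∈ U := by exact_mod_cast hj
  simp [LinearMap.mem_ker, LinearMap.sum_apply, hj']

lemma coordSpan_univ : coordSpan (univ : Finset V) = ⊤ := by
  rw [coordSpan, coe_univ, Set.image_univ]
  rw [← (Pi.basisFun ℝ V).span_eq]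
  congr 2
  funext u
  simp

lemma edgeVec_notMem (he : Joins p q e i u) (hu : u ∈ U) (hi : i ∉ U) :
    edgeVec p q e ∉ coordSpan U := by
  intro h
  have h1 := coordSpan_le_ker (single_mem_of_joins he h (single_mem_coordSpan hu))
  rw [LinearMap.mem_ker, LinearMap.sum_apply] at h1
  simp [hi] at h1

lemma clo_eq_top_iff : clo (edgeVec p q) (coordSpan U) D = ⊤ ↔
    ∀ i, Pi.single i 1 ∈ clo (edgeVec p q) (coordSpan U) D := by
  constructor
  · intro h i
    rw [h]
    trivial
  · intro h
    rw [eq_top_iff, ← coordSpan_univ, coordSpan, Submodule.span_le]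
    rintro _ ⟨j, -, rfl⟩
    exact h j

lemma exists_joins (h : clo (edgeVec p q) (coordSpan U) D = ⊤) (hU : U ≠ univ) :
    ∃ e ∈ D, ∃ i ∉ U, ∃ u ∈ U, Joins p q e i u := by
  by_contra! hcon
  obtain ⟨i, hi⟩ : ∃ i, i ∉ U := by
    by_contra! h'
    exact hU (eq_univ_of_forall h')
  have hle : clo (edgeVec p q) (coordSpan U) D ≤
      LinearMap.ker (∑ j ∈ Uᶜ, (LinearMap.proj j : (V → ℝ) →ₗ[ℝ] ℝ)) := by
    refine sup_le coordSpan_le_ker ?_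
    rw [Submodule.span_le]
    rintro _ ⟨e, he, rfl⟩
    have heD : e ∈ D := by exact_mod_cast he
    have hiff : p e ∈ U ↔ q e ∈ U := by
      constructor
      · intro h1
        by_contra h2
        exact hcon e heD _ h2 _ h1 (Or.inr ⟨rfl, rfl⟩)
      · intro h1
        by_contra h2
        exact hcon e heD _ h2 _ h1 (Or.inl ⟨rfl, rfl⟩)
    simp [LinearMap.mem_ker, LinearMap.sum_apply, edgeVec, hiff]
  rw [h] at hle
  have h1 := hle (Submodule.mem_top (x := Pi.single i (1 : ℝ)))
  rw [LinearMap.mem_ker, LinearMap.sum_apply] at h1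
  simp [hi] at h1

lemma parkCount_of_clo_ne_top (h : clo (edgeVec p q) (coordSpan U) D ≠ ⊤) :
    parkCount p q U D s = 0 := by
  classical
  refine parkCount_eq_zero fun a ha _ => ?_
  rw [Ne, clo_eq_top_iff] at h
  push Not at h
  obtain ⟨i, hi⟩ := h
  set I : Finset V := univ.filter fun i => Pi.single i 1 ∉ clo (edgeVec p q) (coordSpan U) D with hI
  have hd : Disjoint I U := disjoint_left.2 fun j hj hU =>
    (mem_filter.1 hj).2 (Submodule.mem_sup_left (single_mem_coordSpan hU))
  obtain ⟨j, hj, hle⟩ := ha.exists_le I ⟨i, by simp [hI, hi]⟩ hd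
  have h0 : outDeg p q D I j = 0 := by
    rw [outDeg, card_eq_zero, filter_eq_empty_iff]
    rintro e he ⟨k, hk, hjk⟩
    refine (mem_filter.1 hj).2 (single_mem_of_joins hjk (mem_clo he) ?_)
    by_contra hcon
    exact hk (by simp [hI, hcon])
  have := ha.pos j (disjoint_left.1 hd hj)
  omega

lemma card_insert_add (hi : i ∉ U) (hr : U.card + (r + 1) = Fintype.card V) :
    (insert i U).card + r = Fintype.card V := by
  rw [card_insert_of_notMem hi]; omega

lemma parkCount_eq_zero_of_le (hr : U.card + r = Fintype.card V) (hs : D.card + r ≤ s)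
    (h0 : s ≠ 0) : parkCount p q U D s = 0 := by
  induction s generalizing U D r with
  | zero => exact absurd rfl h0
  | succ s ih =>
    by_cases hU : U = univ
    · rw [hU]; exact parkCount_univ h0
    by_cases hcl : clo (edgeVec p q) (coordSpan U) D = ⊤
    swap
    · exact parkCount_of_clo_ne_top hcl
    obtain ⟨e, he, i, hi, u, hu, hj⟩ := exists_joins hcl hU
    have hc := card_pos.2 ⟨e, he⟩
    have hlt := card_lt_univ_of_notMem hi
    obtain ⟨r, rfl⟩ : ∃ r', r = r' + 1 := ⟨r - 1, by omega⟩
    rw [parkCount_succ hj he hu hi, ih hr (by rw [card_erase_of_mem he]; omega) (by omega),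
      ih (card_insert_add hi hr) (by omega) (by omega)]

lemma parkCount_one (hr : U.card + 1 = Fintype.card V)
    (h : clo (edgeVec p q) (coordSpan U) D = ⊤) : parkCount p q U D 1 = 1 := by
  classical
  have hU : U ≠ univ := by
    rintro rfl
    rw [card_univ] at hr
    omega
  obtain ⟨e, he, i, hi, u, hu, hj⟩ := exists_joins h hU
  have hUi : insert i U = univ := by
    rw [← card_eq_iff_eq_univ, card_insert_of_notMem hi, hr]
  rw [parkCount_succ hj he hu hi, hUi, parkCount_eq_zero fun a ha hs => ?_, zero_add, parkCount,
    card_eq_one]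
  · refine ⟨0, ?_⟩
    ext a
    rw [mem_parkCount, mem_singleton]
    constructor
    · exact fun h => h.2.eq_zero_of_univ
    · rintro rfl
      refine ⟨by simp, by simp, by simp, fun I hI hd => ?_⟩
      obtain ⟨j, hj⟩ := hI
      exact absurd (mem_univ j) (disjoint_left.1 hd hj)
  · have := ha.pos i hi
    have := single_le_sum (f := a) (fun _ _ => Nat.zero_le _) (mem_univ i)
    omega

lemma parkCount_eq_zero_of_lt (hr : U.card + r = Fintype.card V) (hs : s < r) :
    parkCount p q U D s = 0 := by
  refine parkCount_eq_zero fun a ha h => ?_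
  have := ha.card_le_sum
  rw [card_compl] at this
  omega

variable {t : E → ℝ} {C : Finset (Finset E)} {k l : ℕ}

lemma clo_insert_eq_top (h : clo (edgeVec p q) (coordSpan U) D = ⊤) :
    clo (edgeVec p q) (coordSpan (insert i U)) D = ⊤ :=
  top_unique (h ▸ sup_le_sup_right (Submodule.span_mono (Set.image_mono (by simp))) _)

lemma hasRank_coordSpan (h : clo (edgeVec p q) (coordSpan U) univ = ⊤)
    (hr : U.card + r = Fintype.card V) : HasRank (edgeVec p q) (coordSpan U) r := by
  induction r generalizing U with
  | zero =>
    intro ω _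
    rw [(card_eq_iff_eq_univ U).1 hr, coordSpan_univ, card_eq_zero, eq_empty_iff_forall_notMem]
    intro f hf
    exact mem_bas.1 hf (Submodule.mem_sup_left trivial)
  | succ r ih =>
    have hU : U ≠ univ := by
      rintro rfl
      rw [card_univ] at hr
      omega
    obtain ⟨e, he, i, hi, u, hu, hj⟩ := exists_joins h hU
    have hk := ih (clo_insert_eq_top (i := i) h) (card_insert_add hi hr)
    intro ω hω
    have := hk ω hω
    rw [coordSpan_insert hj hu] at this
    obtain ⟨f, hf, h', -⟩ := bas_contract (t := fun _ => 0) hω (edgeVec_notMem hj hu hi)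
    rw [h', card_erase_of_mem hf] at this
    have := card_pos.2 ⟨f, hf⟩
    omega

theorem bideg_eq_parkCount (ht : Function.Injective t) (hC : IsTop C D)
    (h : clo (edgeVec p q) (coordSpan U) D = ⊤) (hr : U.card + r = Fintype.card V) (h1 : 1 ≤ r)
    (hd : k + l + 2 = D.card + r) :
    bideg t (edgeVec p q) (coordSpan U) C k l = parkCount p q U D (l + 1) := by
  have hrank : ∀ {U : Finset V} {r : ℕ} {D : Finset E},
      clo (edgeVec p q) (coordSpan U) D = ⊤ → U.card + r = Fintype.card V →
      HasRank (edgeVec p q) (coordSpan U) r := fun h hr =>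
    hasRank_coordSpan (top_unique (h ▸ clo_mono (subset_univ _))) hr
  induction l generalizing U D C r with
  | zero =>
    obtain rfl | h2 := h1.eq_or_lt
    · rw [hC.bideg_zero_eq_one ht (hrank h hr) (by omega), parkCount_one hr h, Nat.cast_one]
    · rw [bideg_zero_eq_zero ht (hrank h hr) h2, parkCount_eq_zero_of_lt hr (by omega),
        Nat.cast_zero]
  | succ l ih =>
    have hU : U ≠ univ := by
      rintro rfl
      rw [card_univ] at hr
      omega
    obtain ⟨e, he, i, hi, u, hu, hj⟩ := exists_joins h hU
    have heW := edgeVec_notMem hj hu hi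
    obtain ⟨r, rfl⟩ : ∃ r', r = r' + 1 := ⟨r - 1, by omega⟩
    have hins := card_insert_add hi hr
    rw [hC.bideg_succ ht he heW (hrank h hr) (by omega), parkCount_succ hj he hu hi, Nat.cast_add,
      add_comm (parkCount p q U (D.erase e) (l + 1) : ℝ), ← coordSpan_insert hj hu]
    congr 1
    · rcases Nat.eq_zero_or_pos r with rfl | hpos
      · rw [bideg, (hrank (clo_insert_eq_top h) hins).deg_eq_zero,
          (card_eq_iff_eq_univ _).1 hins, parkCount_univ (by omega), Nat.cast_zero]
      · exact ih hC (clo_insert_eq_top h) hins hpos (by omega)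
    · by_cases hcl : edgeVec p q e ∈ clo (edgeVec p q) (coordSpan U) (D.erase e)
      · have h0 : D.erase e ≠ ∅ := by
          intro h0
          rw [h0, clo_empty] at hcl
          exact heW hcl
        have htop : clo (edgeVec p q) (coordSpan U) (D.erase e) = ⊤ := by
          rw [← h, ← insert_erase he, clo_insert, erase_insert (notMem_erase e D), sup_span_eq hcl]
        have hc := card_pos.2 ⟨e, he⟩
        rw [cle, if_pos hcl, one_mul,
          ih (hC.erase he h0) htop hr h1 (by rw [card_erase_of_mem he]; omega)]
      · rw [cle, if_neg hcl, zero_mul, parkCount_of_clo_ne_top, Nat.cast_zero]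
        intro htop
        exact hcl (htop ▸ Submodule.mem_top)

theorem parkCount_logConcave (h : clo (edgeVec p q) (coordSpan U) univ = ⊤)
    (hr : U.card + r = Fintype.card V) (h1 : 1 ≤ r) (s : ℕ) :
    parkCount p q U univ s * parkCount p q U univ (s + 2) ≤ parkCount p q U univ (s + 1) ^ 2 := by
  rcases s with _ | l
  · rw [parkCount_eq_zero_of_lt hr (by omega), zero_mul]
    exact Nat.zero_le _
  by_cases hs : Fintype.card E + r ≤ l + 1 + 2
  · rw [parkCount_eq_zero_of_le (D := univ) (s := l + 1 + 2) hr (by rwa [card_univ]) (by omega),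
      mul_zero]
    exact Nat.zero_le _
  obtain ⟨k, hk⟩ : ∃ k, k + l + 4 = Fintype.card E + r :=
    ⟨Fintype.card E + r - (l + 4), by omega⟩
  have hU : U ≠ univ := by
    rintro rfl
    rw [card_univ] at hr
    omega
  obtain ⟨e, -⟩ := exists_joins h hU
  have : Nonempty E := ⟨e⟩
  obtain ⟨t, ht⟩ : ∃ t : E → ℝ, Function.Injective t :=
    ⟨fun e => (Fintype.equivFin E e : ℕ), fun a b hab => by
      simpa [Fin.val_inj] using hab⟩
  have key := bideg_logConcave ht (hasRank_coordSpan h hr) h1 hk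
  rw [bideg_eq_parkCount ht isTop_univ h hr h1 (by rw [card_univ]; omega),
    bideg_eq_parkCount ht isTop_univ h hr h1 (by rw [card_univ]; omega),
    bideg_eq_parkCount ht isTop_univ h hr h1 (by rw [card_univ]; omega)] at key
  exact_mod_cast key

end Graph

section Fin

variable {n : ℕ} (G : SimpleGraph (Fin (n + 1)))

/-- The edges of `G`, each oriented upwards. -/
abbrev Edge := {x : Fin (n + 1) × Fin (n + 1) // x.1 < x.2 ∧ G.Adj x.1 x.2}

/-- The lower endpoint of an edge. -/
def src (e : Edge G) : Fin (n + 1) := e.1.1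

/-- The upper endpoint of an edge. -/
def tgt (e : Edge G) : Fin (n + 1) := e.1.2

variable {G}

lemma Joins.adj {e : Edge G} {i j : Fin (n + 1)} (h : Joins (src G) (tgt G) e i j) : G.Adj i j := by
  rcases h with ⟨rfl, rfl⟩ | ⟨rfl, rfl⟩
  · exact e.2.2
  · exact e.2.2.symm

lemma Joins.right_unique {e : Edge G} {i j k : Fin (n + 1)} (h : Joins (src G) (tgt G) e i j)
    (h' : Joins (src G) (tgt G) e i k) : j = k := by
  have hne : src G e ≠ tgt G e := e.2.1.ne
  rcases h with ⟨rfl, rfl⟩ | ⟨rfl, rfl⟩ <;> rcases h' with ⟨h1, h2⟩ | ⟨h1, h2⟩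
  · exact h2
  · exact absurd h2.symm hne
  · exact absurd h1 hne
  · exact h1

lemma Joins.edge_unique {e f : Edge G} {i j : Fin (n + 1)} (h : Joins (src G) (tgt G) e i j)
    (h' : Joins (src G) (tgt G) f i j) : e = f := by
  have he : src G e < tgt G e := e.2.1
  have hf : src G f < tgt G f := f.2.1
  have key : src G e = src G f ∧ tgt G e = tgt G f := by
    rcases h with ⟨rfl, rfl⟩ | ⟨rfl, rfl⟩ <;> rcases h' with ⟨h1, h2⟩ | ⟨h1, h2⟩
    · exact ⟨h1.symm, h2.symm⟩
    · rw [h1, h2] at hf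
      exact absurd hf he.asymm
    · rw [h1, h2] at hf
      exact absurd hf he.asymm
    · exact ⟨h1.symm, h2.symm⟩
  exact Subtype.ext (Prod.ext key.1 key.2)

lemma exists_joins_of_adj {i j : Fin (n + 1)} (h : G.Adj i j) :
    ∃ e : Edge G, Joins (src G) (tgt G) e i j := by
  rcases lt_or_gt_of_ne h.ne with hlt | hlt
  · exact ⟨⟨(i, j), hlt, h⟩, Or.inl ⟨rfl, rfl⟩⟩
  · exact ⟨⟨(j, i), hlt, h.symm⟩, Or.inr ⟨rfl, rfl⟩⟩

variable [Fintype (Edge G)]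

lemma dOut_eq_outDeg (I : Finset (Fin (n + 1))) (i : Fin (n + 1)) :
    dOut G I i = outDeg (src G) (tgt G) univ I i := by
  classical
  rw [dOut, Nat.card_eq_fintype_card, Fintype.card_subtype, outDeg_eq_card]
  choose f hf using fun j (h : G.Adj i j) => exists_joins_of_adj h
  refine card_bij (fun j hj => f j (mem_filter.1 hj).2.1) ?_ ?_ ?_
  · intro j hj
    rw [mem_filter]
    exact ⟨mem_univ _, j, (mem_filter.1 hj).2.2, hf j _⟩
  · intro j hj k hk hjk
    have h1 := hf j (mem_filter.1 hj).2.1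
    have h2 := hf k (mem_filter.1 hk).2.1
    rw [hjk] at h1
    exact h1.right_unique h2
  · intro e he
    rw [mem_filter] at he
    obtain ⟨-, j, hjI, hj⟩ := he
    exact ⟨j, mem_filter.2 ⟨mem_univ _, hj.adj, hjI⟩, (hf j hj.adj).edge_unique hj⟩

lemma isParking_cons_iff {a : Fin n → ℕ} :
    IsParking (src G) (tgt G) {0} univ (Fin.cons 0 a) ↔ IsGParkingFunction G a := by
  constructor
  · intro h
    refine ⟨fun i => by simpa using h.pos i.succ (by simp), fun I hI => ?_⟩
    obtain ⟨j, hj, hle⟩ := h.exists_le (I.image Fin.succ) (hI.image _) (by simp)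
    obtain ⟨i, hi, rfl⟩ := mem_image.1 hj
    exact ⟨i, hi, by simpa [dOut_eq_outDeg] using hle⟩
  · intro h
    refine ⟨by simp, fun i hi => ?_, fun I hI hd => ?_⟩
    · obtain ⟨j, rfl⟩ := Fin.exists_succ_eq.2 (by simpa using hi : i ≠ 0)
      simpa using h.1 j
    · rw [disjoint_singleton_right] at hd
      have himg : (univ.filter fun i : Fin n => i.succ ∈ I).image Fin.succ = I := by
        ext j
        rw [mem_image]
        constructor
        · rintro ⟨i, hi, rfl⟩
          exact (mem_filter.1 hi).2
        · intro hj
          obtain ⟨i, rfl⟩ := Fin.exists_succ_eq.2 (fun h => hd (h ▸ hj) : j ≠ 0)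
          exact ⟨i, by simpa using hj, rfl⟩
      rw [← himg, image_nonempty] at hI
      obtain ⟨i, hi, hle⟩ := h.2 _ hI
      rw [himg, dOut_eq_outDeg] at hle
      exact ⟨i.succ, (mem_filter.1 hi).2, by simpa using hle⟩

lemma coeff_gpfPoly [Fintype {a : Fin n → ℕ // IsGParkingFunction G a}] (s : ℕ) :
    (gpfPoly G).coeff s = parkCount (src G) (tgt G) {0} univ s := by
  classical
  rw [gpfPoly, finsum_eq_sum_of_fintype, Polynomial.finsetSum_coeff]
  simp only [Polynomial.coeff_X_pow]
  rw [sum_boole, parkCount]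
  congr 1
  refine card_bij (fun a _ => (Fin.cons 0 a.1 : Fin (n + 1) → ℕ)) ?_ ?_ ?_
  · intro a ha
    rw [mem_parkCount, isParking_cons_iff]
    exact ⟨by simpa [Fin.sum_univ_succ] using (mem_filter.1 ha).2.symm, a.2⟩
  · intro a _ b _ hab
    exact Subtype.ext (Fin.cons_inj.1 hab).2
  · intro b hb
    obtain ⟨hs, hb⟩ := mem_parkCount.1 hb
    have h0 : b 0 = 0 := hb.eq_zero 0 (by simp)
    have hcons : Fin.cons 0 (Fin.tail b) = b := by rw [← h0, Fin.cons_self_tail]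
    rw [← hcons, isParking_cons_iff] at hb
    refine ⟨⟨Fin.tail b, hb⟩, mem_filter.2 ⟨mem_univ _, ?_⟩, hcons⟩
    rw [← hs, Fin.sum_univ_succ, h0, zero_add]
    rfl

lemma clo_eq_top_of_connected (hG : G.Connected) :
    clo (edgeVec (src G) (tgt G)) (coordSpan {0}) univ = ⊤ := by
  refine clo_eq_top_iff.2 fun i => ?_
  have key : ∀ {j k : Fin (n + 1)} (_ : G.Walk j k),
      Pi.single k 1 ∈ clo (edgeVec (src G) (tgt G)) (coordSpan {0}) univ →
      Pi.single j 1 ∈ clo (edgeVec (src G) (tgt G)) (coordSpan {0}) univ := by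
    intro j k w hk
    induction w with
    | nil => exact hk
    | cons h _ ih =>
      obtain ⟨e, he⟩ := exists_joins_of_adj h
      exact single_mem_of_joins he (mem_clo (mem_univ e)) (ih hk)
  obtain ⟨w⟩ := hG.preconnected i 0
  exact key w (Submodule.mem_sup_left (single_mem_coordSpan (by simp)))

end Fin

end GParking
/-- For any loopless connected graph `G` on `{0, ..., n}`, the `G`-parking function sum
enumerator `P_G(x)` has log-concave coefficients. -/
theorem gpfPoly_logConcave (n : ℕ) (G : SimpleGraph (Fin (n + 1))) (hG : G.Connected) :
    PolyLogConcave (gpfPoly G) := by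
  classical
  intro s
  cases finite_or_infinite {a : Fin n → ℕ // IsGParkingFunction G a} with
  | inr hinf =>
    have : gpfPoly G = 0 := finsum_of_infinite_support <| by
      rw [Function.support_eq_univ fun a => by simp]
      exact Set.infinite_univ
    simp [this]
  | inl hfin =>
    have := Fintype.ofFinite {a : Fin n → ℕ // IsGParkingFunction G a}
    simp only [GParking.coeff_gpfPoly]
    rcases n with _ | n
    · rw [show ({0} : Finset (Fin (0 + 1))) = Finset.univ by decide,
        GParking.parkCount_univ (s := s + 2) (by omega)]
      simp
    · exact_mod_cast GParking.parkCount_logConcave (r := n + 1)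
        (GParking.clo_eq_top_of_connected hG) (by simp [add_comm]) (by omega) s
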